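/- (Case p = n of the generalized Hodge type inequality.) Let K₁, …, K_n be nonempty compact convex sets in ℝⁿ. Then MV(K₁, …, K_n)^n ≥ Π_{i=1}^{n} (n! · vol(K_i)). -/

import Mathlib

open scoped Pointwise
open MeasureTheory Finset

/-- Lebesgue volume of a subset of ℝⁿ, as a real number. -/
noncomputable def vol {n : ℕ} (A : Set (Fin n → ℝ)) : ℝ := (volume A).toReal

/-- The mixed volume of `n` convex bodies in ℝⁿ, defined by the inclusion–exclusion
formula. -/
noncomputable def MV (n : ℕ) (K : Fin n → Set (Fin n → ℝ)) : ℝ :=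
  ∑ j ∈ Finset.Icc 1 n, (-1 : ℝ) ^ (n - j) *
    ∑ S ∈ Finset.univ.powersetCard j, vol (∑ i ∈ S, K i)



theorem MV_eq_sum {n : ℕ} (hn : 1 ≤ n) (K : Fin n → Set (Fin n → ℝ)) :
    MV n K = ∑ S : Finset (Fin n), (-1 : ℝ) ^ (n - S.card) * vol (∑ i ∈ S, K i) := by
  have h0 : vol (0 : Set (Fin n → ℝ)) = 0 := by
    have : Nonempty (Fin n) := ⟨⟨0, hn⟩⟩
    unfold vol
    rw [← Set.singleton_zero]
    simp
  have := Finset.sum_powerset (Finset.univ : Finset (Fin n))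
    (fun S => (-1 : ℝ) ^ (n - S.card) * vol (∑ i ∈ S, K i))
  rw [Finset.powerset_univ] at this
  rw [this, Finset.card_univ, Fintype.card_fin, Finset.sum_range_succ', MV]
  simp only [Finset.powersetCard_zero, Finset.sum_singleton, Finset.sum_empty, h0, mul_zero,
    add_zero]
  rw [Finset.range_eq_Ico, Finset.sum_Ico_add' (f := fun j => ∑ t ∈ powersetCard j univ,
    (-1 : ℝ) ^ (n - t.card) * vol (∑ i ∈ t, K i)) 0 n 1]
  have : Finset.Ico (0+1) (n+1) = Finset.Icc 1 n := by ext; simp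
  rw [this]
  refine Finset.sum_congr rfl fun j _ => ?_
  rw [Finset.mul_sum]
  refine Finset.sum_congr rfl fun S hS => ?_
  rw [(Finset.mem_powersetCard.1 hS).2]

theorem alt_sum_superset {n : ℕ} (r : Fin n → Fin n) :
    ∑ S : Finset (Fin n), (if ∀ j, r j ∈ S then (-1 : ℝ) ^ (n - S.card) else 0) =
      if Function.Bijective r then 1 else 0 := by
  classical
  have h1 : ∑ S : Finset (Fin n), (if ∀ j, r j ∈ S then (-1 : ℝ) ^ (n - S.card) else 0) =
      ∑ T : Finset (Fin n), (if T ⊆ (Finset.univ.image r)ᶜ then (-1 : ℝ) ^ (T.card) else 0) := by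
    refine Fintype.sum_equiv (Equiv.ofBijective (fun S : Finset (Fin n) => Sᶜ)
      compl_bijective) _ _ fun S => ?_
    simp only [Equiv.ofBijective_apply, Finset.card_compl, Fintype.card_fin]
    congr 1
    rw [Finset.compl_subset_compl, Finset.image_subset_iff]
    simp
  rw [h1, ← Finset.sum_filter]
  have h2 : Finset.univ.filter (fun T => T ⊆ (Finset.univ.image r)ᶜ) =
      ((Finset.univ.image r)ᶜ).powerset := by ext; simp
  rw [h2]
  have h3 := Finset.sum_powerset_neg_one_pow_card (x := (Finset.univ.image r)ᶜ)
  have h4 := congrArg (Int.cast : ℤ → ℝ) h3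
  push_cast at h4
  rw [h4]
  congr 1
  rw [Finset.compl_eq_empty_iff, ← Finite.surjective_iff_bijective]
  simp [Finset.eq_univ_iff_forall, Function.Surjective]

theorem polarize {n : ℕ} {V : Type*} [AddCommMonoid V] [Module ℝ V]
    (f : MultilinearMap ℝ (fun _ : Fin n => V) ℝ) (v : Fin n → Fin n → V) :
    ∑ S : Finset (Fin n), (-1 : ℝ) ^ (n - S.card) * f (fun j => ∑ i ∈ S, v i j) =
      ∑ σ : Equiv.Perm (Fin n), f (fun j => v (σ j) j) := by
  classical
  have h1 : ∀ S : Finset (Fin n), (-1 : ℝ) ^ (n - S.card) * f (fun j => ∑ i ∈ S, v i j) =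
      ∑ r : Fin n → Fin n, (if ∀ j, r j ∈ S then (-1 : ℝ) ^ (n - S.card) else 0) *
        f (fun j => v (r j) j) := by
    intro S
    rw [f.map_sum_finset (fun j i => v i j) (fun _ => S), Finset.mul_sum]
    simp only [ite_mul, zero_mul]
    rw [← Finset.sum_filter]
    refine Finset.sum_congr ?_ fun _ _ => rfl
    ext; simp
  simp_rw [h1]
  rw [Finset.sum_comm]
  simp_rw [← Finset.sum_mul, alt_sum_superset, ite_mul, one_mul, zero_mul]
  rw [← Finset.sum_filter]
  symm
  refine Finset.sum_bij (fun σ _ => ⇑σ) ?_ ?_ ?_ ?_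
  · intro σ _; rw [Finset.mem_filter]; exact ⟨Finset.mem_univ _, σ.bijective⟩
  · intro a _ b _ h; exact Equiv.coe_fn_injective h
  · intro r hr
    exact ⟨Equiv.ofBijective r (by simpa using hr), by simp, rfl⟩
  · intro _ _; rfl

/-- mixed discriminant -/
noncomputable def mdisc {n : ℕ} (H : Fin n → Matrix (Fin n) (Fin n) ℝ) : ℝ :=
  ∑ S : Finset (Fin n), (-1 : ℝ) ^ (n - S.card) * (∑ i ∈ S, H i).det

theorem mdisc_eq {n : ℕ} (H : Fin n → Matrix (Fin n) (Fin n) ℝ) :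
    mdisc H = ∑ σ : Equiv.Perm (Fin n), (Matrix.of fun j => H (σ j) j).det := by
  have := polarize (Matrix.detRowAlternating (R := ℝ) (n := Fin n)).toMultilinearMap
    (fun i j => H i j)
  refine Eq.trans ?_ this
  unfold mdisc
  refine Finset.sum_congr rfl fun S _ => ?_
  congr 1
  change _ = Matrix.det _
  congr 1
  ext i j
  simp [Matrix.sum_apply]

open scoped MatrixOrder Matrix.Norms.L2Operator in
theorem mdisc_nonneg {n : ℕ} (H : Fin n → Matrix (Fin n) (Fin n) ℝ)
    (hH : ∀ i, (H i).PosSemidef) : 0 ≤ mdisc H := by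
  classical
  have h1 : ∀ i, ∃ B : Matrix (Fin n) (Fin n) ℝ, H i = B.transpose * B := by
    intro i
    obtain ⟨B, hB⟩ := CStarAlgebra.nonneg_iff_eq_star_mul_self.1 (hH i).nonneg
    exact ⟨B, by simpa [Matrix.star_eq_conjTranspose] using hB⟩
  choose B hB using h1
  rw [mdisc_eq]
  have h2 : ∀ σ : Equiv.Perm (Fin n), (Matrix.of fun j => H (σ j) j).det =
      ∑ k : Fin n → Fin n, (∏ j, B (σ j) (k (σ j)) j) * ((Equiv.Perm.sign σ : ℤ) : ℝ) *
        (Matrix.of fun i => B i (k i)).det := by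
    intro σ
    have e : (Matrix.of fun j => H (σ j) j) =
        (fun j => ∑ k : Fin n, B (σ j) k j • B (σ j) k) := by
      ext j l
      simp [hB, Matrix.mul_apply, Finset.sum_apply]
    rw [e]
    have := (Matrix.detRowAlternating (R := ℝ) (n := Fin n)).toMultilinearMap.map_sum
      (fun j k => B (σ j) k j • B (σ j) k)
    refine Eq.trans this ?_
    symm
    refine Fintype.sum_equiv (Equiv.arrowCongr σ.symm (Equiv.refl (Fin n))) _ _ fun k => ?_
    have h3 := (Matrix.detRowAlternating (R := ℝ) (n := Fin n)).toMultilinearMap.map_smul_univ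
      (fun j => B (σ j) (k (σ j)) j) (fun j => B (σ j) (k (σ j)))
    refine Eq.trans ?_ (Eq.trans h3.symm ?_)
    · rw [smul_eq_mul, mul_assoc]
      congr 1
      exact (Matrix.det_permute σ (Matrix.of fun i => B i (k i))).symm
    · congr 1
  simp_rw [h2]
  rw [Finset.sum_comm]
  refine Finset.sum_nonneg fun k _ => ?_
  rw [← Finset.sum_mul]
  have h4 : ∑ σ : Equiv.Perm (Fin n), (∏ j, B (σ j) (k (σ j)) j) *
      ((Equiv.Perm.sign σ : ℤ) : ℝ) = (Matrix.of fun i => B i (k i)).det := by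
    rw [Matrix.det_apply']
    refine Finset.sum_congr rfl fun σ _ => ?_
    rw [mul_comm]; rfl
  rw [h4]
  exact mul_self_nonneg _

theorem perm_prod_pow {n : ℕ} (g : Fin n → ℝ) (j : Fin n) :
    (∏ σ : Equiv.Perm (Fin n), g (σ j)) ^ n = (∏ i, g i) ^ n.factorial := by
  classical
  have h1 : ∀ l, ∏ σ : Equiv.Perm (Fin n), g (σ l) = ∏ σ : Equiv.Perm (Fin n), g (σ j) := by
    intro l
    refine Fintype.prod_equiv (Equiv.mulRight (Equiv.swap j l)) _ _ fun σ => ?_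
    simp
  have h2 : ∏ l, ∏ σ : Equiv.Perm (Fin n), g (σ l) =
      (∏ σ : Equiv.Perm (Fin n), g (σ j)) ^ n := by
    simp [h1]
  rw [← h2, Finset.prod_comm]
  have h3 : ∀ σ : Equiv.Perm (Fin n), ∏ l, g (σ l) = ∏ i, g i := fun σ =>
    Equiv.prod_comp σ g
  simp [h3, Fintype.card_perm]

theorem perm_ineq {n : ℕ} (hn : 1 ≤ n) (d : Fin n → Fin n → ℝ) (hd : ∀ i j, 0 ≤ d i j) :
    (n.factorial : ℝ) * (∏ i, ∏ j, d i j) ^ ((1 : ℝ) / n) ≤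
      ∑ σ : Equiv.Perm (Fin n), ∏ j, d (σ j) j := by
  classical
  have hn0 : (n : ℝ) ≠ 0 := by positivity
  have hf : (0 : ℝ) < n.factorial := by positivity
  have am := Real.geom_mean_le_arith_mean (Finset.univ : Finset (Equiv.Perm (Fin n)))
    (fun _ => 1) (fun σ => ∏ j, d (σ j) j) (fun _ _ => zero_le_one)
    (by simp [Fintype.card_perm]; positivity)
    (fun σ _ => Finset.prod_nonneg fun j _ => hd _ _)
  simp only [Real.rpow_one, Finset.sum_const, Finset.card_univ, Fintype.card_perm,
    Fintype.card_fin, nsmul_eq_mul, mul_one, one_mul] at am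
  have hQ : (∏ σ : Equiv.Perm (Fin n), ∏ j, d (σ j) j) ^ n =
      (∏ i, ∏ j, d i j) ^ n.factorial := by
    rw [Finset.prod_comm, ← Finset.prod_pow]
    simp_rw [fun j => perm_prod_pow (fun i => d i j) j]
    rw [Finset.prod_pow, Finset.prod_comm]
  have hQ0 : 0 ≤ ∏ σ : Equiv.Perm (Fin n), ∏ j, d (σ j) j :=
    Finset.prod_nonneg fun σ _ => Finset.prod_nonneg fun j _ => hd _ _
  have hP0 : 0 ≤ ∏ i, ∏ j, d i j :=
    Finset.prod_nonneg fun σ _ => Finset.prod_nonneg fun j _ => hd _ _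
  have e : (∏ σ : Equiv.Perm (Fin n), ∏ j, d (σ j) j) ^ ((n.factorial : ℝ)⁻¹) =
      (∏ i, ∏ j, d i j) ^ ((1 : ℝ) / n) := by
    have : (∏ σ : Equiv.Perm (Fin n), ∏ j, d (σ j) j) =
        ((∏ i, ∏ j, d i j) ^ n.factorial) ^ ((1 : ℝ) / n) := by
      rw [← hQ, one_div, Real.pow_rpow_inv_natCast hQ0 (by omega)]
    rw [this, ← Real.rpow_natCast, ← Real.rpow_mul hP0, ← Real.rpow_mul hP0]
    congr 1
    field_simp
  rw [e, le_div_iff₀ hf] at am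
  linarith

theorem Icc_add_Icc_pi {n : ℕ} (a b c d : Fin n → ℝ) (h1 : a ≤ b) (h2 : c ≤ d) :
    Set.Icc a b + Set.Icc c d = Set.Icc (a + c) (b + d) := by
  apply Set.Subset.antisymm
  · rintro _ ⟨x, hx, y, hy, rfl⟩
    exact ⟨add_le_add hx.1 hy.1, add_le_add hx.2 hy.2⟩
  · intro x hx
    refine ⟨a ⊔ (x - d), ⟨le_sup_left, sup_le h1 ?_⟩, x - (a ⊔ (x - d)), ⟨?_, ?_⟩, by simp⟩
    · exact sub_le_iff_le_add.2 hx.2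
    · rw [le_sub_comm]
      exact sup_le (le_sub_iff_add_le.2 hx.1) (sub_le_sub_left h2 x)
    · rw [sub_le_comm]
      exact le_sup_right

theorem sum_Icc_pi {n : ℕ} {ι : Type*} (S : Finset ι) (a b : ι → Fin n → ℝ)
    (h : ∀ i, a i ≤ b i) :
    ∑ i ∈ S, Set.Icc (a i) (b i) = Set.Icc (∑ i ∈ S, a i) (∑ i ∈ S, b i) := by
  classical
  induction S using Finset.induction_on with
  | empty => simp [← Set.singleton_zero]
  | insert i S hi ih =>
    rw [Finset.sum_insert hi, Finset.sum_insert hi, Finset.sum_insert hi, ih,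
      Icc_add_Icc_pi _ _ _ _ (h i) (Finset.sum_le_sum fun i _ => h i)]

theorem MV_box {n : ℕ} (hn : 1 ≤ n) (a b : Fin n → Fin n → ℝ) (h : ∀ i, a i ≤ b i) :
    (n.factorial : ℝ) * (∏ i, vol (Set.Icc (a i) (b i))) ^ ((1 : ℝ) / n) ≤
      MV n (fun i => Set.Icc (a i) (b i)) := by
  have hv : ∀ (a b : Fin n → ℝ), a ≤ b → vol (Set.Icc a b) = ∏ j, (b j - a j) :=
    fun a b h => Real.volume_Icc_pi_toReal h
  rw [MV_eq_sum hn]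
  simp_rw [hv _ _ (h _)]
  refine (perm_ineq hn (fun i j => b i j - a i j) (fun i j => sub_nonneg.2 (h i j))).trans ?_
  have := polarize (MultilinearMap.mkPiAlgebra ℝ (Fin n) ℝ) (fun i j => b i j - a i j)
  simp only [MultilinearMap.mkPiAlgebra_apply] at this
  rw [← this]
  refine le_of_eq (Finset.sum_congr rfl fun S _ => ?_)
  rw [sum_Icc_pi S a b h, hv _ _ (Finset.sum_le_sum fun i _ => h i)]
  simp [Finset.sum_apply]


/-- weighted Laplace integral -/
noncomputable def LI {n : ℕ} (K : Set (Fin n → ℝ)) (w f : (Fin n → ℝ) → ℝ) (u : Fin n → ℝ) : ℝ :=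
  ∫ x in K, f x * (w x * Real.exp (∑ j, u j * x j))

theorem LI_integrable {n : ℕ} {K : Set (Fin n → ℝ)} (hK : IsCompact K) {w f : (Fin n → ℝ) → ℝ}
    (hw : Continuous w) (hf : Continuous f) (u : Fin n → ℝ) :
    IntegrableOn (fun x => f x * (w x * Real.exp (∑ j, u j * x j))) K := by
  apply ContinuousOn.integrableOn_compact hK
  apply Continuous.continuousOn
  fun_prop

theorem LI_hasFDerivAt {n : ℕ} {K : Set (Fin n → ℝ)} (hK : IsCompact K) {w f : (Fin n → ℝ) → ℝ}
    (hw : Continuous w) (hf : Continuous f) (u : Fin n → ℝ) :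
    HasFDerivAt (LI K w f) (∑ j, LI K w (fun x => f x * x j) u •
      (ContinuousLinearMap.proj j : (Fin n → ℝ) →L[ℝ] ℝ)) u := by
  let F' : (Fin n → ℝ) → (Fin n → ℝ) → ((Fin n → ℝ) →L[ℝ] ℝ) := fun v x =>
    ∑ j, ((f x * x j) * (w x * Real.exp (∑ j, v j * x j))) •
      (ContinuousLinearMap.proj j : (Fin n → ℝ) →L[ℝ] ℝ)
  have hF'c : Continuous (fun p : (Fin n → ℝ) × (Fin n → ℝ) => F' p.1 p.2) := by
    simp only [F']
    fun_prop
  obtain ⟨C, hC⟩ := ((isCompact_closedBall u 1).prod hK).exists_bound_of_continuousOn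
    hF'c.continuousOn
  have key : HasFDerivAt (fun v => ∫ x in K, f x * (w x * Real.exp (∑ j, v j * x j)))
      (∫ x in K, F' u x) u := by
    refine hasFDerivAt_integral_of_dominated_of_fderiv_le (s := Metric.closedBall u 1)
      (bound := fun _ => C) (F' := F')
      (Metric.closedBall_mem_nhds u one_pos) ?_ ?_ ?_ ?_ ?_ ?_
    · refine Filter.Eventually.of_forall fun v => ?_
      apply Continuous.aestronglyMeasurable
      fun_prop
    · exact LI_integrable hK hw hf u
    · apply Continuous.aestronglyMeasurable
      exact hF'c.comp (by fun_prop : Continuous fun x => (u, x))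
    · refine (ae_restrict_iff' hK.measurableSet).2 (Filter.Eventually.of_forall ?_)
      intro x hx v hv
      exact hC (v, x) ⟨hv, hx⟩
    · have : IsFiniteMeasure (volume.restrict K) := ⟨by simpa using hK.measure_lt_top⟩
      exact integrable_const C
    · refine Filter.Eventually.of_forall fun x v _ => ?_
      have h1 : HasFDerivAt (fun v : Fin n → ℝ => ∑ j, v j * x j)
          (∑ j, x j • (ContinuousLinearMap.proj j : (Fin n → ℝ) →L[ℝ] ℝ)) v := by
        refine HasFDerivAt.fun_sum fun j _ => ?_
        exact (ContinuousLinearMap.proj (R := ℝ) (φ := fun _ : Fin n => ℝ) j).hasFDerivAt.mul_const (x j)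
      have h2 := ((h1.exp.const_mul (w x)).const_mul (f x))
      refine h2.congr_fderiv ?_
      simp only [F', Finset.smul_sum, smul_smul]
      refine Finset.sum_congr rfl fun j _ => ?_
      congr 1
      ring
  have e : ∫ x in K, F' u x = ∑ j, LI K w (fun x => f x * x j) u •
      (ContinuousLinearMap.proj j : (Fin n → ℝ) →L[ℝ] ℝ) := by
    simp only [F']
    rw [integral_finsetSum]
    · refine Finset.sum_congr rfl fun j _ => ?_
      rw [integral_smul_const]
      rfl
    · intro j _
      apply Integrable.smul_const
      exact LI_integrable hK hw (by fun_prop : Continuous fun x => f x * x j) u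
  rw [← e]
  exact key

theorem LI_continuous {n : ℕ} {K : Set (Fin n → ℝ)} (hK : IsCompact K) {w f : (Fin n → ℝ) → ℝ}
    (hw : Continuous w) (hf : Continuous f) : Continuous (LI K w f) :=
  continuous_iff_continuousAt.2 fun u => (LI_hasFDerivAt hK hw hf u).continuousAt

theorem LI_pos {n : ℕ} {K : Set (Fin n → ℝ)} (hK : IsCompact K) {w f : (Fin n → ℝ) → ℝ}
    (hw : Continuous w) (hw0 : ∀ x, 0 < w x) (hf : Continuous f) (hf0 : ∀ x, 0 ≤ f x)
    (hne : ∃ x ∈ interior K, f x ≠ 0) (u : Fin n → ℝ) : 0 < LI K w f u := by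
  unfold LI
  rw [setIntegral_pos_iff_support_of_nonneg_ae]
  · obtain ⟨x, hx, hfx⟩ := hne
    have hs : Function.support (fun x => f x * (w x * Real.exp (∑ j, u j * x j))) =
      {x | f x ≠ 0} := by
      ext y
      simp [(hw0 y).ne']
    rw [hs]
    have ho : IsOpen ({x | f x ≠ 0} ∩ interior K) :=
      (isOpen_ne_fun hf continuous_const).inter isOpen_interior
    exact lt_of_lt_of_le (ho.measure_pos volume ⟨x, hfx, hx⟩)
      (measure_mono (Set.inter_subset_inter_right _ interior_subset))
  · refine Filter.Eventually.of_forall fun x => ?_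
    have := hw0 x
    have := hf0 x
    simp only [Pi.zero_apply]
    positivity
  · exact LI_integrable hK hw hf u

theorem LI_add {n : ℕ} {K : Set (Fin n → ℝ)} (hK : IsCompact K) {w f g : (Fin n → ℝ) → ℝ}
    (hw : Continuous w) (hf : Continuous f) (hg : Continuous g) (u : Fin n → ℝ) :
    LI K w (fun x => f x + g x) u = LI K w f u + LI K w g u := by
  unfold LI
  rw [← integral_add (LI_integrable hK hw hf u) (LI_integrable hK hw hg u)]
  congr 1; ext x; ring

theorem LI_const_mul {n : ℕ} {K : Set (Fin n → ℝ)} {w f : (Fin n → ℝ) → ℝ}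
    (c : ℝ) (u : Fin n → ℝ) :
    LI K w (fun x => c * f x) u = c * LI K w f u := by
  unfold LI
  rw [← integral_const_mul]
  congr 1; ext x; ring

theorem LI_sum {n : ℕ} {K : Set (Fin n → ℝ)} (hK : IsCompact K) {ι : Type*} (s : Finset ι)
    {w : (Fin n → ℝ) → ℝ} {f : ι → (Fin n → ℝ) → ℝ}
    (hw : Continuous w) (hf : ∀ i, Continuous (f i)) (u : Fin n → ℝ) :
    LI K w (fun x => ∑ i ∈ s, f i x) u = ∑ i ∈ s, LI K w (f i) u := by
  unfold LI
  rw [← integral_finsetSum _ fun i _ => LI_integrable hK hw (hf i) u]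
  congr 1; ext x; rw [Finset.sum_mul]

/-- gradient of log-Laplace -/
noncomputable def LG {n : ℕ} (K : Set (Fin n → ℝ)) (w : (Fin n → ℝ) → ℝ) (u : Fin n → ℝ) :
    Fin n → ℝ := fun j => LI K w (fun x => x j) u / LI K w (fun _ => 1) u

/-- Hessian of log-Laplace -/
noncomputable def LH {n : ℕ} (K : Set (Fin n → ℝ)) (w : (Fin n → ℝ) → ℝ) (u : Fin n → ℝ) :
    Matrix (Fin n) (Fin n) ℝ := Matrix.of fun j k =>
  LI K w (fun x => x j * x k) u / LI K w (fun _ => 1) u -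
    LI K w (fun x => x j) u * LI K w (fun x => x k) u / (LI K w (fun _ => 1) u) ^ 2

/-- admissible body -/
structure Adm {n : ℕ} (K : Set (Fin n → ℝ)) (w : (Fin n → ℝ) → ℝ) : Prop where
  cpt : IsCompact K
  conv : Convex ℝ K
  int : (interior K).Nonempty
  cont : Continuous w
  pos : ∀ x, 0 < w x

theorem Adm.Zpos {n : ℕ} {K : Set (Fin n → ℝ)} {w : (Fin n → ℝ) → ℝ} (h : Adm K w)
    (u : Fin n → ℝ) : 0 < LI K w (fun _ => 1) u := by
  obtain ⟨x, hx⟩ := h.int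
  exact LI_pos h.cpt h.cont h.pos continuous_const (fun _ => zero_le_one) ⟨x, hx, one_ne_zero⟩ u

theorem LG_hasFDerivAt {n : ℕ} {K : Set (Fin n → ℝ)} {w : (Fin n → ℝ) → ℝ} (h : Adm K w)
    (u : Fin n → ℝ) :
    HasFDerivAt (LG K w) (LinearMap.toContinuousLinearMap (Matrix.toLin' (LH K w u))) u := by
  rw [hasFDerivAt_pi']
  intro j
  have h1 := LI_hasFDerivAt h.cpt h.cont (continuous_apply j) u
  have h2 := LI_hasFDerivAt h.cpt h.cont (continuous_const (y := (1 : ℝ))) u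
  have hZ := (h.Zpos u).ne'
  have h3 := h1.fun_mul ((hasDerivAt_inv hZ).comp_hasFDerivAt u h2)
  refine (h3.congr_fderiv ?_)
  ext v
  simp [LH, Matrix.mulVec, dotProduct, Finset.mul_sum]
  rw [← Finset.sum_neg_distrib, ← Finset.sum_add_distrib]
  refine Finset.sum_congr rfl fun k _ => ?_
  field_simp
  ring

theorem logZ_hasFDerivAt {n : ℕ} {K : Set (Fin n → ℝ)} {w : (Fin n → ℝ) → ℝ} (h : Adm K w)
    (u : Fin n → ℝ) :
    HasFDerivAt (fun u => Real.log (LI K w (fun _ => 1) u))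
      (∑ j, LG K w u j • (ContinuousLinearMap.proj j : (Fin n → ℝ) →L[ℝ] ℝ)) u := by
  have h2 := LI_hasFDerivAt h.cpt h.cont (continuous_const (y := (1 : ℝ))) u
  have hZ := (h.Zpos u).ne'
  have h3 := h2.log hZ
  refine h3.congr_fderiv ?_
  simp only [LG, Finset.smul_sum, smul_smul, one_mul]
  refine Finset.sum_congr rfl fun k _ => ?_
  rw [div_eq_inv_mul]

theorem LH_quad {n : ℕ} {K : Set (Fin n → ℝ)} {w : (Fin n → ℝ) → ℝ} (h : Adm K w)
    (u v : Fin n → ℝ) :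
    dotProduct v ((LH K w u).mulVec v) =
      LI K w (fun x => (∑ j, v j * x j - ∑ j, v j * LG K w u j) ^ 2) u /
        LI K w (fun _ => 1) u := by
  have hZ := (h.Zpos u).ne'
  set Z := LI K w (fun _ => 1) u with hZd
  set c := ∑ j, v j * LG K w u j with hc
  have e1 : (fun x : Fin n → ℝ => (∑ j, v j * x j - c) ^ 2) =
      fun x => ((∑ j, ∑ k, (v j * v k) * (x j * x k)) + ((-2 * c) * ∑ j, v j * x j)) + c ^ 2 * 1 := by
    ext x
    have : ∑ j, ∑ k, (v j * v k) * (x j * x k) = (∑ j, v j * x j) * ∑ j, v j * x j := by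
      rw [Finset.sum_mul_sum]
      refine Finset.sum_congr rfl fun j _ => Finset.sum_congr rfl fun k _ => by ring
    rw [this]; ring
  have hlin : LI K w (fun x => ∑ j, v j * x j) u = c * Z := by
    rw [LI_sum h.cpt _ h.cont (fun j => by fun_prop), hc, Finset.sum_mul]
    refine Finset.sum_congr rfl fun j _ => ?_
    rw [LI_const_mul, LG, ← hZd]
    field_simp
  rw [e1, LI_add h.cpt h.cont (by fun_prop) (by fun_prop),
    LI_add h.cpt h.cont (by fun_prop) (by fun_prop), LI_const_mul, LI_const_mul, hlin, ← hZd,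
    LI_sum h.cpt _ h.cont (fun j => by fun_prop)]
  have e2 : ∀ j, LI K w (fun x => ∑ k, (v j * v k) * (x j * x k)) u =
      ∑ k, (v j * v k) * LI K w (fun x => x j * x k) u := by
    intro j
    rw [LI_sum h.cpt _ h.cont (fun j => by fun_prop)]
    exact Finset.sum_congr rfl fun k _ => LI_const_mul _ _
  simp_rw [e2]
  have e3 : c ^ 2 = ∑ j, ∑ k, (v j * LG K w u j) * (v k * LG K w u k) := by
    rw [sq, hc, Finset.sum_mul_sum]
  have e4 : dotProduct v ((LH K w u).mulVec v) =
      (∑ j, ∑ k, (v j * v k) * LI K w (fun x => x j * x k) u) / Z - c ^ 2 := by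
    rw [e3, Finset.sum_div, ← Finset.sum_sub_distrib]
    simp only [dotProduct, Matrix.mulVec]
    refine Finset.sum_congr rfl fun j _ => ?_
    rw [Finset.mul_sum, Finset.sum_div, ← Finset.sum_sub_distrib]
    refine Finset.sum_congr rfl fun k _ => ?_
    simp only [LH, LG, Matrix.of_apply, ← hZd]
    field_simp
  rw [e4]
  field_simp
  ring

theorem LH_posDef {n : ℕ} {K : Set (Fin n → ℝ)} {w : (Fin n → ℝ) → ℝ} (h : Adm K w)
    (u : Fin n → ℝ) : (LH K w u).PosDef := by
  refine Matrix.PosDef.of_dotProduct_mulVec_pos ?_ ?_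
  · ext j k
    simp only [LH, Matrix.conjTranspose_apply, Matrix.of_apply, star_trivial]
    simp_rw [mul_comm]
  · intro v hv
    rw [star_trivial, LH_quad h]
    refine div_pos (LI_pos h.cpt h.cont h.pos (by fun_prop) (fun x => sq_nonneg _) ?_ u) (h.Zpos u)
    by_contra! hcon
    obtain ⟨x, hx⟩ := h.int
    have ht : ∀ᶠ t : ℝ in nhds 0, x + t • v ∈ interior K := by
      have : Continuous fun t : ℝ => x + t • v := by fun_prop
      exact this.continuousAt.eventually (isOpen_interior.mem_nhds (by simpa using hx))
    obtain ⟨ε, hε, hb⟩ := Metric.eventually_nhds_iff.1 ht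
    have hm := hb (y := ε / 2) (by simp [abs_of_pos hε]; linarith)
    have h1 := pow_eq_zero_iff (two_ne_zero) |>.1 (hcon x hx)
    have h2 := pow_eq_zero_iff (two_ne_zero) |>.1 (hcon _ hm)
    have h3 : ε / 2 * ∑ j, v j * v j = 0 := by
      have : ∑ j, v j * (x + (ε / 2) • v) j = ∑ j, v j * x j + ε / 2 * ∑ j, v j * v j := by
        rw [Finset.mul_sum, ← Finset.sum_add_distrib]
        refine Finset.sum_congr rfl fun j _ => ?_
        simp; ring
      linarith
    have h4 : ∑ j, v j * v j = 0 := by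
      rcases mul_eq_zero.1 h3 with h | h
      · linarith
      · exact h
    exact hv (dotProduct_self_eq_zero.1 h4)


theorem LG_mem {n : ℕ} {K : Set (Fin n → ℝ)} {w : (Fin n → ℝ) → ℝ} (h : Adm K w)
    (u : Fin n → ℝ) : LG K w u ∈ K := by
  by_contra hcon
  obtain ⟨f, c, hf, hc⟩ := geometric_hahn_banach_closed_point h.conv h.cpt.isClosed hcon
  have hZ := h.Zpos u
  let a : Fin n → ℝ := fun j => f (Pi.single j 1)
  have hfa : ∀ x, f x = ∑ j, a j * x j := by
    intro x
    have := LinearMap.pi_apply_eq_sum_univ (f : (Fin n → ℝ) →ₗ[ℝ] ℝ) x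
    simp only [smul_eq_mul] at this
    refine Eq.trans this (Finset.sum_congr rfl fun j _ => ?_)
    rw [mul_comm]
    have hk : (fun k => if j = k then (1 : ℝ) else 0) = Pi.single j 1 := by
      ext k
      simp [Pi.single_apply, eq_comm]
    rw [hk]
    rfl
  have h1 : f (LG K w u) * LI K w (fun _ => 1) u = LI K w (fun x => ∑ j, a j * x j) u := by
    rw [hfa, LI_sum h.cpt _ h.cont (fun j => by fun_prop), Finset.sum_mul]
    refine Finset.sum_congr rfl fun j _ => ?_
    rw [LI_const_mul, LG]
    field_simp
  have h2 : LI K w (fun x => ∑ j, a j * x j) u ≤ LI K w (fun _ => c * 1) u := by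
    unfold LI
    refine setIntegral_mono_on (LI_integrable h.cpt h.cont (by fun_prop) u)
      (LI_integrable h.cpt h.cont (by fun_prop) u) h.cpt.measurableSet fun x hx => ?_
    have := (hf x hx).le
    rw [hfa] at this
    have := h.pos x
    rw [mul_one]
    gcongr
  rw [LI_const_mul, ← h1] at h2
  exact absurd (le_of_mul_le_mul_right h2 hZ) (not_le.2 hc)

theorem LG_sum_inj {n : ℕ} {K : Fin n → Set (Fin n → ℝ)} {w : Fin n → (Fin n → ℝ) → ℝ}
    (h : ∀ i, Adm (K i) (w i)) (S : Finset (Fin n)) (hS : S.Nonempty) :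
    Function.Injective (fun u => ∑ i ∈ S, LG (K i) (w i) u) := by
  intro u v huv
  by_contra hne
  set d := v - u with hd
  have hd0 : d ≠ 0 := sub_ne_zero.2 (Ne.symm hne)
  have hder : ∀ t : ℝ, HasDerivAt (fun t : ℝ => ∑ i ∈ S, dotProduct d (LG (K i) (w i) (u + t • d)))
      (∑ i ∈ S, dotProduct d ((LH (K i) (w i) (u + t • d)).mulVec d)) t := by
    intro t
    refine HasDerivAt.fun_sum fun i _ => ?_
    have h1 : HasDerivAt (fun t : ℝ => u + t • d) d t := by
      simpa using ((hasDerivAt_id t).smul_const d).const_add u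
    have h2 := (LG_hasFDerivAt (h i) (u + t • d)).comp_hasDerivAt t h1
    have h3 := hasDerivAt_pi.1 h2
    simp only [dotProduct]
    refine HasDerivAt.fun_sum fun j _ => ?_
    exact (h3 j).const_mul (d j)
  have hmono := strictMono_of_hasDerivAt_pos hder (fun t => by
    refine Finset.sum_pos (fun i _ => ?_) hS
    have := (LH_posDef (h i) (u + t • d)).dotProduct_mulVec_pos hd0
    simpa using this)
  have := hmono (zero_lt_one)
  simp only [zero_smul, add_zero, one_smul, ← dotProduct_sum] at this
  have e : u + d = v := by simp [hd]
  simp only at huv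
  rw [e, huv] at this
  exact lt_irrefl _ this

theorem coercive {n : ℕ} {K : Set (Fin n → ℝ)} {w : (Fin n → ℝ) → ℝ} (h : Adm K w)
    {x₀ : Fin n → ℝ} (hx : x₀ ∈ interior K) :
    ∃ r > 0, ∃ c : ℝ, ∀ u : Fin n → ℝ,
      r * ‖u‖ + c ≤ Real.log (LI K w (fun _ => 1) u) - ∑ j, u j * x₀ j := by
  obtain ⟨ε, hε, hball⟩ := Metric.nhds_basis_closedBall.mem_iff.1 (mem_interior_iff_mem_nhds.1 hx)
  obtain ⟨y, hy, hmin⟩ := h.cpt.exists_isMinOn ⟨x₀, interior_subset hx⟩ h.cont.continuousOn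
  set r := ε / 2 with hr
  have hr0 : 0 < r := by positivity
  set V := (volume (Metric.closedBall (0 : Fin n → ℝ) (r / 2))).toReal with hV
  have hV0 : 0 < V := ENNReal.toReal_pos
    (Metric.measure_closedBall_pos volume _ (by positivity)).ne'
    (measure_closedBall_lt_top).ne
  refine ⟨r, hr0, Real.log (w y * V), fun u => ?_⟩
  let s : Fin n → ℝ := fun j => if 0 ≤ u j then 1 else -1
  have hs : ∀ j, |s j| ≤ 1 := by intro j; simp only [s]; split_ifs <;> simp
  have hus : ∀ j, u j * s j = |u j| := by
    intro j; simp only [s]; split_ifs with h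
    · rw [abs_of_nonneg h, mul_one]
    · rw [abs_of_neg (not_le.1 h)]; ring
  set B := Metric.closedBall (x₀ + (3 / 2 * r) • s) (r / 2) with hB
  have hBx : ∀ x ∈ B, ∀ j, |x j - x₀ j - 3 / 2 * r * s j| ≤ r / 2 := by
    intro x hx j
    have := (dist_le_pi_dist x (x₀ + (3 / 2 * r) • s) j).trans hx
    rw [Real.dist_eq] at this
    have e : x j - x₀ j - 3 / 2 * r * s j = x j - (x₀ + (3 / 2 * r) • s) j := by
      rw [Pi.add_apply, Pi.smul_apply, smul_eq_mul]; ring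
    rw [e]
    exact this
  have hBK : B ⊆ K := by
    intro x hx
    apply hball
    rw [Metric.mem_closedBall, dist_pi_le_iff hε.le]
    intro j
    rw [Real.dist_eq]
    have h1 := abs_le.1 (hBx x hx j)
    have h2 := abs_le.1 (hs j)
    rw [abs_le]
    constructor <;> nlinarith
  have hlow : ∀ x ∈ B, w y * Real.exp (∑ j, u j * x₀ j + r * ‖u‖) ≤
      1 * (w x * Real.exp (∑ j, u j * x j)) := by
    intro x hx
    rw [one_mul]
    have hw := hmin (hBK hx)
    have hp := h.pos y
    have hn : r * ‖u‖ ≤ ∑ j, r * |u j| := by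
      rw [← Finset.mul_sum]
      gcongr
      refine (pi_norm_le_iff_of_nonneg (Finset.sum_nonneg fun j _ => abs_nonneg _)).2 fun j => ?_
      exact Finset.single_le_sum (f := fun j => |u j|) (fun j _ => abs_nonneg _) (Finset.mem_univ j)
    have hsum : ∑ j, u j * x₀ j + r * ‖u‖ ≤ ∑ j, u j * x j := by
      refine (add_le_add_right hn _).trans ?_
      rw [← Finset.sum_add_distrib]
      refine Finset.sum_le_sum fun j _ => ?_
      have h1 := hBx x hx j
      have h3 : |u j * (x j - x₀ j - 3 / 2 * r * s j)| ≤ |u j| * (r / 2) := by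
        rw [abs_mul]; gcongr
      have h4 := (abs_le.1 h3).1
      have h5 := hus j
      nlinarith
    have := Real.exp_le_exp.2 hsum
    have hw' : w y ≤ w x := hw
    have := (h.pos x).le
    gcongr
  have hZ : w y * Real.exp (∑ j, u j * x₀ j + r * ‖u‖) * V ≤ LI K w (fun _ => 1) u := by
    have hint := LI_integrable h.cpt h.cont (continuous_const (y := (1 : ℝ))) u
    have h1 := setIntegral_ge_of_const_le_real (μ := volume) (Metric.isClosed_closedBall.measurableSet)
      (measure_closedBall_lt_top).ne hlow (hint.mono_set hBK)
    have h2 : volume.real B = V := by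
      rw [hV, hB, Measure.real, Measure.addHaar_closedBall_center]
    rw [h2] at h1
    refine h1.trans ?_
    unfold LI
    refine setIntegral_mono_set hint ?_ (Filter.Eventually.of_forall hBK)
    refine Filter.Eventually.of_forall fun x => ?_
    have := h.pos x
    simp only [Pi.zero_apply]
    positivity
  have hp := h.pos y
  have := Real.log_le_log (by positivity) hZ
  rw [mul_right_comm, Real.log_mul (by positivity) (by positivity), Real.log_exp] at this
  linarith

theorem LG_sum_surj {n : ℕ} {K : Fin n → Set (Fin n → ℝ)} {w : Fin n → (Fin n → ℝ) → ℝ}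
    (h : ∀ i, Adm (K i) (w i)) (S : Finset (Fin n)) (hS : S.Nonempty) :
    ∑ i ∈ S, interior (K i) ⊆ Set.range (fun u => ∑ i ∈ S, LG (K i) (w i) u) := by
  intro x hx
  rw [Set.mem_finsetSum] at hx
  obtain ⟨g, hg, rfl⟩ := hx
  have hc : ∀ i : Fin n, ∃ r > 0, ∃ c : ℝ, i ∈ S → ∀ u : Fin n → ℝ,
      r * ‖u‖ + c ≤ Real.log (LI (K i) (w i) (fun _ => 1) u) - ∑ j, u j * g i j := by
    intro i
    by_cases hi : i ∈ S
    · obtain ⟨r, hr, c, hc⟩ := coercive (h i) (hg hi)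
      exact ⟨r, hr, c, fun _ => hc⟩
    · exact ⟨1, one_pos, 0, fun h => absurd h hi⟩
  choose r hr c hc using hc
  let P : (Fin n → ℝ) → ℝ := fun u =>
    ∑ i ∈ S, (Real.log (LI (K i) (w i) (fun _ => 1) u) - ∑ j, u j * g i j)
  have hder : ∀ u, HasFDerivAt P (∑ i ∈ S, (∑ j, LG (K i) (w i) u j •
      (ContinuousLinearMap.proj j : (Fin n → ℝ) →L[ℝ] ℝ) -
      ∑ j, g i j • (ContinuousLinearMap.proj j : (Fin n → ℝ) →L[ℝ] ℝ))) u := by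
    intro u
    refine HasFDerivAt.fun_sum fun i _ => ?_
    refine (logZ_hasFDerivAt (h i) u).fun_sub ?_
    refine HasFDerivAt.fun_sum fun j _ => ?_
    exact (ContinuousLinearMap.proj (R := ℝ) (φ := fun _ : Fin n => ℝ) j).hasFDerivAt.mul_const _
  have hPc : Continuous P := continuous_iff_continuousAt.2 fun u => (hder u).continuousAt
  have hcoer : Filter.Tendsto P (Filter.cocompact _) Filter.atTop := by
    have h1 : Filter.Tendsto (fun u : Fin n → ℝ => (∑ i ∈ S, r i) * ‖u‖ + ∑ i ∈ S, c i)
        (Filter.cocompact _) Filter.atTop := by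
      refine Filter.tendsto_atTop_add_const_right _ _ ?_
      exact (tendsto_norm_cocompact_atTop (E := Fin n → ℝ)).const_mul_atTop
        (Finset.sum_pos (fun i _ => hr i) hS)
    refine Filter.tendsto_atTop_mono (fun u => ?_) h1
    rw [Finset.sum_mul, ← Finset.sum_add_distrib]
    exact Finset.sum_le_sum fun i hi => hc i hi u
  obtain ⟨u, hu⟩ := hPc.exists_forall_le hcoer
  refine ⟨u, ?_⟩
  have h0 := IsLocalMin.hasFDerivAt_eq_zero (Filter.Eventually.of_forall hu) (hder u)
  ext k
  have := congrArg (fun L : (Fin n → ℝ) →L[ℝ] ℝ => L (Pi.single k 1)) h0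
  simp [Pi.single_apply, Finset.sum_sub_distrib, sub_eq_zero] at this
  simpa [Finset.sum_apply] using this

theorem sum_subset_closure {n : ℕ} {K : Fin n → Set (Fin n → ℝ)}
    (hconv : ∀ i, Convex ℝ (K i)) (hint : ∀ i, (interior (K i)).Nonempty) (S : Finset (Fin n)) :
    ∑ i ∈ S, K i ⊆ closure (∑ i ∈ S, interior (K i)) := by
  intro x hx
  rw [Set.mem_finsetSum] at hx
  obtain ⟨g, hg, rfl⟩ := hx
  choose p hp using hint
  have ht : Filter.Tendsto (fun t : ℝ => ∑ i ∈ S, (g i + t • (p i - g i))) (nhdsWithin 0 (Set.Ioc 0 1))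
      (nhds (∑ i ∈ S, g i)) := by
    have : Continuous (fun t : ℝ => ∑ i ∈ S, (g i + t • (p i - g i))) := by fun_prop
    have h2 := this.tendsto 0
    simp only [zero_smul, add_zero] at h2
    exact h2.mono_left nhdsWithin_le_nhds
  have hne : (nhdsWithin (0 : ℝ) (Set.Ioc 0 1)).NeBot := by
    rw [nhdsWithin_Ioc_eq_nhdsGT one_pos]; infer_instance
  refine mem_closure_of_tendsto ht ?_
  filter_upwards [self_mem_nhdsWithin] with t ht
  rw [Set.mem_finsetSum]
  exact ⟨fun i => g i + t • (p i - g i), fun {i} hi =>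
    (hconv i).add_smul_sub_mem_interior (hg hi) (hp i) ht, rfl⟩

theorem vol_sum_lintegral {n : ℕ} {K : Fin n → Set (Fin n → ℝ)} {w : Fin n → (Fin n → ℝ) → ℝ}
    (h : ∀ i, Adm (K i) (w i)) (S : Finset (Fin n)) (hS : S.Nonempty) :
    ∫⁻ u, ENNReal.ofReal ((∑ i ∈ S, LH (K i) (w i) u).det) = volume (∑ i ∈ S, K i) := by
  have key := lintegral_abs_det_fderiv_eq_addHaar_image (volume : Measure (Fin n → ℝ))
    (f := fun u => ∑ i ∈ S, LG (K i) (w i) u)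
    (f' := fun u => ∑ i ∈ S, LinearMap.toContinuousLinearMap (Matrix.toLin' (LH (K i) (w i) u)))
    MeasurableSet.univ
    (fun u _ => (HasFDerivAt.fun_sum fun i _ => LG_hasFDerivAt (h i) u).hasFDerivWithinAt)
    (LG_sum_inj h S hS).injOn
  rw [Measure.restrict_univ, Set.image_univ] at key
  have e : ∀ u, |(∑ i ∈ S, LinearMap.toContinuousLinearMap
      (Matrix.toLin' (LH (K i) (w i) u))).det| = (∑ i ∈ S, LH (K i) (w i) u).det := by
    intro u
    have : (∑ i ∈ S, LinearMap.toContinuousLinearMap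
      (Matrix.toLin' (LH (K i) (w i) u))).det = (∑ i ∈ S, LH (K i) (w i) u).det := by
      rw [← map_sum, ← map_sum]
      rw [ContinuousLinearMap.det, LinearMap.coe_toContinuousLinearMap, LinearMap.det_toLin']
    rw [this, abs_of_nonneg]
    exact (Matrix.posSemidef_sum _ fun i _ => (LH_posDef (h i) u).posSemidef).det_nonneg
  simp_rw [e] at key
  rw [key]
  apply le_antisymm
  · apply measure_mono
    rintro _ ⟨u, rfl⟩
    exact Set.finsetSum_mem_finsetSum _ _ _ fun i _ => LG_mem (h i) u
  · have hc : Convex ℝ (∑ i ∈ S, interior (K i)) := convex_sum _ fun i _ => (h i).conv.interior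
    calc volume (∑ i ∈ S, K i) ≤ volume (closure (∑ i ∈ S, interior (K i))) :=
          measure_mono (sum_subset_closure (fun i => (h i).conv) (fun i => (h i).int) S)
      _ ≤ volume (∑ i ∈ S, interior (K i)) + volume (frontier (∑ i ∈ S, interior (K i))) := by
          rw [closure_eq_self_union_frontier]
          exact measure_union_le _ _
      _ = volume (∑ i ∈ S, interior (K i)) := by rw [hc.addHaar_frontier volume, add_zero]
      _ ≤ _ := measure_mono (LG_sum_surj h S hS)

theorem sum_compact {n : ℕ} {K : Fin n → Set (Fin n → ℝ)} (h : ∀ i, IsCompact (K i))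
    (S : Finset (Fin n)) : IsCompact (∑ i ∈ S, K i) := by
  classical
  induction S using Finset.induction_on with
  | empty => rw [Finset.sum_empty, ← Set.singleton_zero]; exact isCompact_singleton
  | insert i S hi ih => rw [Finset.sum_insert hi]; exact (h i).add ih

theorem LH_continuous {n : ℕ} {K : Set (Fin n → ℝ)} {w : (Fin n → ℝ) → ℝ} (h : Adm K w) :
    Continuous (LH K w) := by
  refine continuous_matrix fun j k => ?_
  simp only [LH, Matrix.of_apply]
  have hZ := fun u => (h.Zpos u).ne'
  refine ((LI_continuous h.cpt h.cont (by fun_prop)).div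
    (LI_continuous h.cpt h.cont (by fun_prop)) hZ).sub (((LI_continuous h.cpt h.cont
      (by fun_prop)).mul (LI_continuous h.cpt h.cont (by fun_prop))).div
      ((LI_continuous h.cpt h.cont (by fun_prop)).pow 2) fun u => pow_ne_zero 2 (hZ u))

theorem mdisc_continuous {n : ℕ} : Continuous (mdisc (n := n)) := by
  unfold mdisc
  refine continuous_finsetSum _ fun S _ => ?_
  refine continuous_const.mul (Continuous.matrix_det ?_)
  fun_prop

theorem MV_lintegral {n : ℕ} (hn : 1 ≤ n) {K : Fin n → Set (Fin n → ℝ)}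
    {w : Fin n → (Fin n → ℝ) → ℝ} (h : ∀ i, Adm (K i) (w i)) :
    ∫⁻ u, ENNReal.ofReal (mdisc fun i => LH (K i) (w i) u) = ENNReal.ofReal (MV n K) ∧
      0 ≤ MV n K := by
  have hnn : Nonempty (Fin n) := ⟨⟨0, hn⟩⟩
  have hps : ∀ S : Finset (Fin n), ∀ u, 0 ≤ (∑ i ∈ S, LH (K i) (w i) u).det := fun S u =>
    (Matrix.posSemidef_sum _ fun i _ => (LH_posDef (h i) u).posSemidef).det_nonneg
  have hcont : ∀ S : Finset (Fin n), Continuous fun u => (∑ i ∈ S, LH (K i) (w i) u).det :=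
    fun S => Continuous.matrix_det (continuous_finsetSum _ fun i _ => LH_continuous (h i))
  have hS : ∀ S : Finset (Fin n), Integrable (fun u => (∑ i ∈ S, LH (K i) (w i) u).det) ∧
      ∫ u, (∑ i ∈ S, LH (K i) (w i) u).det = vol (∑ i ∈ S, K i) := by
    intro S
    rcases S.eq_empty_or_nonempty with rfl | hSn
    · have : vol (0 : Set (Fin n → ℝ)) = 0 := by
        unfold vol; rw [← Set.singleton_zero]; simp
      simp [this]
    · have hl := vol_sum_lintegral h S hSn
      have hfin : volume (∑ i ∈ S, K i) ≠ ⊤ :=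
        (sum_compact (fun i => (h i).cpt) S).measure_lt_top.ne
      constructor
      · refine ⟨(hcont S).aestronglyMeasurable, ?_⟩
        rw [hasFiniteIntegral_iff_ofReal (Filter.Eventually.of_forall (hps S)), hl]
        exact hfin.lt_top
      · rw [integral_eq_lintegral_of_nonneg_ae (Filter.Eventually.of_forall (hps S))
          (hcont S).aestronglyMeasurable, hl]
        rfl
  have hI : ∫ u, mdisc (fun i => LH (K i) (w i) u) = MV n K := by
    rw [MV_eq_sum hn]
    unfold mdisc
    rw [integral_finsetSum _ fun S _ => (hS S).1.const_mul _]
    refine Finset.sum_congr rfl fun S _ => ?_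
    rw [integral_const_mul, (hS S).2]
  have hint : Integrable (fun u => mdisc (fun i => LH (K i) (w i) u)) := by
    unfold mdisc
    exact integrable_finsetSum _ fun S _ => (hS S).1.const_mul _
  have hnn : ∀ u, 0 ≤ mdisc (fun i => LH (K i) (w i) u) := fun u =>
    mdisc_nonneg _ fun i => (LH_posDef (h i) u).posSemidef
  constructor
  · rw [← hI, ofReal_integral_eq_lintegral_ofReal hint (Filter.Eventually.of_forall hnn)]
  · rw [← hI]; exact integral_nonneg hnn


theorem LH_scale {n : ℕ} {K : Set (Fin n → ℝ)} {w w' : (Fin n → ℝ) → ℝ} {u v : Fin n → ℝ} {k : ℝ}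
    (hk : k ≠ 0) (h : ∀ f, LI K w f v = k * LI K w' f u) : LH K w v = LH K w' u := by
  ext i j
  simp only [LH, Matrix.of_apply, h]
  by_cases hZ : LI K w' (fun _ => 1) u = 0
  · simp [hZ]
  · field_simp

/-- the half space in direction `s * x a` -/
def HS {n : ℕ} (s : ℝ) (a : Fin n) (c : ℝ) : Set (Fin n → ℝ) := {x | s * (c - x a) ≤ 0}

theorem HS_closed {n : ℕ} (s : ℝ) (a : Fin n) (c : ℝ) : IsClosed (HS s a c) :=
  isClosed_le (by fun_prop) continuous_const

theorem HS_convex {n : ℕ} (s : ℝ) (a : Fin n) (c : ℝ) : Convex ℝ (HS s a c) := by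
  intro x hx y hy p q hp hq hpq
  simp only [HS, Set.mem_ofPred_eq, Pi.add_apply, Pi.smul_apply, smul_eq_mul] at *
  have : s * (c - (p * x a + q * y a)) = p * (s * (c - x a)) + q * (s * (c - y a)) := by
    have : c = (p + q) * c := by rw [hpq, one_mul]
    nth_rewrite 1 [this]; ring
  rw [this]
  nlinarith

theorem LI_shift {n : ℕ} (K : Set (Fin n → ℝ)) (s : ℝ) (hs : s = 1 ∨ s = -1) (a : Fin n) (c M : ℝ)
    (u : Fin n → ℝ) (f : (Fin n → ℝ) → ℝ) :
    LI K (fun x => Real.exp (-M * |x a - c|)) f (u + Pi.single a (s * M)) =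
      Real.exp (M * s * c) * LI K (fun x => Real.exp (-(2 * M) * max (s * (c - x a)) 0)) f u := by
  unfold LI
  rw [← integral_const_mul]
  congr 1
  ext x
  have h1 : ∑ j, (u + (Pi.single a (s * M) : Fin n → ℝ)) j * x j = ∑ j, u j * x j + s * M * x a := by
    simp only [Pi.add_apply, add_mul, Finset.sum_add_distrib]
    congr 1
    rw [Finset.sum_eq_single a] <;> simp +contextual
  rw [h1]
  have h2 : -M * |x a - c| + (∑ j, u j * x j + s * M * x a) =
      M * s * c + (-(2 * M) * max (s * (c - x a)) 0 + ∑ j, u j * x j) := by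
    rcases hs with rfl | rfl <;> rcases le_total (x a) c with hx | hx
    · rw [abs_of_nonpos (by linarith), max_eq_left (by linarith)]; ring
    · rw [abs_of_nonneg (by linarith), max_eq_right (by linarith)]; ring
    · rw [abs_of_nonpos (by linarith), max_eq_right (by linarith)]; ring
    · rw [abs_of_nonneg (by linarith), max_eq_left (by linarith)]; ring
  rw [← Real.exp_add, h2, Real.exp_add, Real.exp_add]
  ring

theorem LI_tendsto {n : ℕ} {K : Set (Fin n → ℝ)} (hK : IsCompact K) (s : ℝ) (a : Fin n) (c : ℝ)
    (u : Fin n → ℝ) {f : (Fin n → ℝ) → ℝ} (hf : Continuous f) :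
    Filter.Tendsto (fun M : ℕ => LI K (fun x => Real.exp (-(2 * (M : ℝ)) * max (s * (c - x a)) 0)) f u)
      Filter.atTop (nhds (LI (K ∩ HS s a c) (fun _ => 1) f u)) := by
  unfold LI
  rw [← setIntegral_indicator (HS_closed s a c).measurableSet]
  refine tendsto_integral_of_dominated_convergence
    (fun x => ‖f x * (1 * Real.exp (∑ j, u j * x j))‖) ?_ ?_ ?_ ?_
  · intro M
    apply Continuous.aestronglyMeasurable
    fun_prop
  · exact (LI_integrable hK continuous_const hf u).norm
  · intro M
    refine Filter.Eventually.of_forall fun x => ?_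
    rw [norm_mul, norm_mul, norm_mul, norm_mul]
    have : ‖Real.exp (-(2 * (M : ℝ)) * max (s * (c - x a)) 0)‖ ≤ ‖(1 : ℝ)‖ := by
      rw [Real.norm_eq_abs, Real.abs_exp, norm_one, Real.exp_le_one_iff]
      have : 0 ≤ (2 * (M : ℝ)) * max (s * (c - x a)) 0 := by positivity
      linarith
    gcongr
  · refine Filter.Eventually.of_forall fun x => ?_
    by_cases hx : x ∈ HS s a c
    · rw [Set.indicator_of_mem hx]
      have : max (s * (c - x a)) 0 = 0 := max_eq_right hx
      simp only [this, mul_zero, Real.exp_zero]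
      exact tendsto_const_nhds
    · rw [Set.indicator_of_notMem hx]
      have h0 : 0 < s * (c - x a) := not_le.1 hx
      have h1 : Filter.Tendsto (fun M : ℕ => Real.exp (-(2 * (M : ℝ)) * max (s * (c - x a)) 0))
          Filter.atTop (nhds 0) := by
        refine Real.tendsto_exp_atBot.comp ?_
        rw [max_eq_left h0.le]
        have : Filter.Tendsto (fun M : ℕ => (M : ℝ) * (2 * (s * (c - x a)))) Filter.atTop
            Filter.atTop := tendsto_natCast_atTop_atTop.atTop_mul_const (by positivity)
        refine (Filter.tendsto_neg_atTop_atBot.comp this).congr fun M => ?_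
        simp only [Function.comp]; ring
      have h2 := (h1.mul_const (Real.exp (∑ j, u j * x j))).const_mul (f x)
      simpa using h2

theorem mdisc_tendsto {n : ℕ} {K : Fin n → Set (Fin n → ℝ)} (hK : ∀ i, IsCompact (K i))
    (hconv : ∀ i, Convex ℝ (K i)) (s : ℝ) (hs : s = 1 ∨ s = -1)
    (a : Fin n) (c : Fin n → ℝ) (hint : ∀ i, (interior (K i ∩ HS s a (c i))).Nonempty)
    (u : Fin n → ℝ) :
    Filter.Tendsto (fun M : ℕ => mdisc fun i => LH (K i)
        (fun x => Real.exp (-(M : ℝ) * |x a - c i|)) (u + Pi.single a (s * M)))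
      Filter.atTop (nhds (mdisc fun i => LH (K i ∩ HS s a (c i)) (fun _ => 1) u)) := by
  refine (mdisc_continuous.tendsto _).comp ?_
  refine tendsto_pi_nhds.2 fun i => ?_
  have hA : Adm (K i ∩ HS s a (c i)) (fun _ => 1) :=
    ⟨(hK i).inter_right (HS_closed _ _ _), (hconv i).inter (HS_convex _ _ _), hint i,
      continuous_const, fun _ => one_pos⟩
  have hZ := (hA.Zpos u).ne'
  have e : ∀ M : ℕ, LH (K i) (fun x => Real.exp (-(M : ℝ) * |x a - c i|)) (u + Pi.single a (s * M))
      = LH (K i) (fun x => Real.exp (-(2 * (M : ℝ)) * max (s * (c i - x a)) 0)) u := fun M =>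
    LH_scale (Real.exp_ne_zero (M * s * c i)) fun f => LI_shift (K i) s hs a (c i) M u f
  simp_rw [e]
  refine tendsto_pi_nhds.2 fun j => tendsto_pi_nhds.2 fun k => ?_
  simp only [LH, Matrix.of_apply]
  have hT := fun (f : (Fin n → ℝ) → ℝ) (hf : Continuous f) => LI_tendsto (hK i) s a (c i) u hf
  exact ((hT _ (by fun_prop)).div (hT _ (by fun_prop)) hZ).sub
    (((hT _ (by fun_prop)).mul (hT _ (by fun_prop))).div ((hT _ (by fun_prop)).pow 2)
      (pow_ne_zero 2 hZ))

theorem MV_cut {n : ℕ} (hn : 1 ≤ n) {K : Fin n → Set (Fin n → ℝ)} (hK : ∀ i, IsCompact (K i))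
    (hconv : ∀ i, Convex ℝ (K i)) (a : Fin n) (c : Fin n → ℝ)
    (hp : ∀ i, (interior (K i ∩ HS 1 a (c i))).Nonempty)
    (hm : ∀ i, (interior (K i ∩ HS (-1) a (c i))).Nonempty) :
    MV n (fun i => K i ∩ HS 1 a (c i)) + MV n (fun i => K i ∩ HS (-1) a (c i)) ≤ MV n K := by
  have hAs : ∀ s, (∀ i, (interior (K i ∩ HS s a (c i))).Nonempty) →
      ∀ i, Adm (K i ∩ HS s a (c i)) (fun _ => 1) := fun s hint i =>
    ⟨(hK i).inter_right (HS_closed _ _ _), (hconv i).inter (HS_convex _ _ _), hint i,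
      continuous_const, fun _ => one_pos⟩
  have hAM : ∀ M : ℕ, ∀ i, Adm (K i) (fun x => Real.exp (-(M : ℝ) * |x a - c i|)) := fun M i =>
    ⟨hK i, hconv i, (hp i).mono (interior_mono Set.inter_subset_left), by fun_prop,
      fun _ => Real.exp_pos _⟩
  let D : ℕ → (Fin n → ℝ) → ENNReal := fun M u => ENNReal.ofReal
    (mdisc fun i => LH (K i) (fun x => Real.exp (-(M : ℝ) * |x a - c i|)) u)
  have hDm : ∀ M, Measurable (D M) := fun M => by
    refine ENNReal.measurable_ofReal.comp (Continuous.measurable ?_)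
    exact mdisc_continuous.comp (continuous_pi fun i => LH_continuous (hAM M i))
  let P : ℝ → Set (Fin n → ℝ) := fun s => {u | 0 < s * u a}
  have hPm : ∀ s, MeasurableSet (P s) := fun s =>
    (isOpen_lt continuous_const (by fun_prop)).measurableSet
  let g : ℝ → ℕ → (Fin n → ℝ) → ENNReal := fun s M => (P s).indicator (D M)
  have hgm : ∀ s M, Measurable (g s M) := fun s M => (hDm M).indicator (hPm s)
  let F : ℕ → (Fin n → ℝ) → ENNReal := fun M u =>
    g 1 M (u + Pi.single a (1 * (M : ℝ))) + g (-1) M (u + Pi.single a (-1 * (M : ℝ)))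
  have hgm' : ∀ s M, Measurable fun u : Fin n → ℝ => g s M (u + (Pi.single a (s * (M : ℝ)) : Fin n → ℝ)) :=
    fun s M => (hgm s M).comp (measurable_id.add_const _)
  have hFint : ∀ M, ∫⁻ u, F M u ≤ ENNReal.ofReal (MV n K) := by
    intro M
    simp only [F]
    rw [lintegral_add_left (hgm' 1 M), lintegral_add_right_eq_self, lintegral_add_right_eq_self,
      ← lintegral_add_left (hgm 1 M), ← (MV_lintegral hn (hAM M)).1]
    refine lintegral_mono fun u => ?_
    change (P 1).indicator (D M) u + (P (-1)).indicator (D M) u ≤ D M u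
    by_cases h1 : u ∈ P 1
    · have h2 : u ∉ P (-1) := by
        simp only [P, Set.mem_ofPred_eq] at h1 ⊢; linarith
      simp [h1, h2]
    · rw [Set.indicator_of_notMem h1, zero_add]
      exact Set.indicator_le_self _ _ _
  have hlim : ∀ s, s = 1 ∨ s = -1 → (∀ i, (interior (K i ∩ HS s a (c i))).Nonempty) → ∀ u,
      Filter.Tendsto (fun M : ℕ => g s M (u + Pi.single a (s * (M : ℝ)))) Filter.atTop
        (nhds (ENNReal.ofReal (mdisc fun i => LH (K i ∩ HS s a (c i)) (fun _ => 1) u))) := by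
    intro s hs hint u
    have h1 := (ENNReal.continuous_ofReal.tendsto _).comp (mdisc_tendsto hK hconv s hs a c hint u)
    refine h1.congr' ?_
    obtain ⟨N, hN⟩ := exists_nat_gt (|u a|)
    filter_upwards [Filter.eventually_ge_atTop N] with M hM
    have hNM : (N : ℝ) ≤ M := by exact_mod_cast hM
    have : u + Pi.single a (s * (M : ℝ)) ∈ P s := by
      simp only [P, Set.mem_ofPred_eq, Pi.add_apply, Pi.single_eq_same]
      have := abs_lt.1 (hN.trans_le hNM)
      rcases hs with rfl | rfl <;> linarith
    simp only [g, Set.indicator_of_mem this, D, Function.comp]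
  have hFlim : ∀ u, Filter.liminf (fun M => F M u) Filter.atTop =
      ENNReal.ofReal (mdisc fun i => LH (K i ∩ HS 1 a (c i)) (fun _ => 1) u) +
      ENNReal.ofReal (mdisc fun i => LH (K i ∩ HS (-1) a (c i)) (fun _ => 1) u) := fun u =>
    ((hlim 1 (Or.inl rfl) hp u).add (hlim (-1) (Or.inr rfl) hm u)).liminf_eq
  have hfatou := lintegral_liminf_le (μ := volume) (u := Filter.atTop) (f := F)
    (fun M => (hgm' 1 M).add (hgm' (-1) M))
  simp_rw [hFlim] at hfatou
  have hmeas : Measurable fun u => ENNReal.ofReal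
      (mdisc fun i => LH (K i ∩ HS 1 a (c i)) (fun _ => 1) u) := by
    refine ENNReal.measurable_ofReal.comp (Continuous.measurable ?_)
    exact mdisc_continuous.comp (continuous_pi fun i => LH_continuous (hAs 1 hp i))
  have hle : Filter.liminf (fun M => ∫⁻ u, F M u) Filter.atTop ≤ ENNReal.ofReal (MV n K) := by
    refine (Filter.liminf_le_liminf (Filter.Eventually.of_forall hFint)).trans ?_
    rw [Filter.liminf_const]
  have := hfatou.trans hle
  obtain ⟨hp1, hp2⟩ := MV_lintegral hn (hAs 1 hp)
  obtain ⟨hm1, hm2⟩ := MV_lintegral hn (hAs (-1) hm)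
  obtain ⟨_, h2⟩ := MV_lintegral hn (hAM 0)
  rw [lintegral_add_left hmeas, hp1, hm1, ← ENNReal.ofReal_add hp2 hm2] at this
  exact (ENNReal.ofReal_le_ofReal_iff h2).1 this


theorem mem_HS1 {n : ℕ} {a : Fin n} {c : ℝ} {x : Fin n → ℝ} : x ∈ HS 1 a c ↔ c ≤ x a := by
  simp [HS]

theorem mem_HSm {n : ℕ} {a : Fin n} {c : ℝ} {x : Fin n → ℝ} : x ∈ HS (-1) a c ↔ x a ≤ c := by
  simp [HS]

theorem int_of_pos {n : ℕ} {K : Set (Fin n → ℝ)} (hc : Convex ℝ K) (h : 0 < vol K) :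
    (interior K).Nonempty := by
  by_contra hne
  rw [Set.not_nonempty_iff_eq_empty] at hne
  have h0 : volume K = 0 := by
    refine measure_mono_null (t := frontier K) ?_ (hc.addHaar_frontier volume)
    intro x hx
    exact ⟨subset_closure hx, by simp [hne]⟩
  simp [vol, h0] at h

theorem vol_halves {n : ℕ} (A : Set (Fin n → ℝ)) (hA : volume A ≠ ⊤)
    (a : Fin n) (c : ℝ) : vol (A ∩ HS 1 a c) + vol (A ∩ HS (-1) a c) = vol A := by
  have h1 : volume (A ∩ HS (-1) a c) = volume (A \ HS 1 a c) := by
    refine measure_congr ?_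
    have h0 : volume {x : Fin n → ℝ | x a = c} = 0 := by
      rw [volume_pi]; exact Measure.pi_hyperplane (α := fun _ : Fin n => ℝ) (fun _ => volume) a c
    filter_upwards [measure_eq_zero_iff_ae_notMem.1 h0] with x hx
    have hx' : x a ≠ c := hx
    apply propext
    show x ∈ A ∩ HS (-1) a c ↔ x ∈ A \ HS 1 a c
    simp only [Set.mem_inter_iff, Set.mem_sdiff, mem_HS1, mem_HSm, not_le]
    refine and_congr_right fun _ => ⟨fun h => lt_of_le_of_ne h hx', le_of_lt⟩
  unfold vol
  rw [h1, ← ENNReal.toReal_add (ne_top_of_le_ne_top hA (measure_mono Set.inter_subset_left))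
    (ne_top_of_le_ne_top hA (measure_mono Set.sdiff_subset)),
    measure_inter_add_sdiff _ (HS_closed 1 a c).measurableSet]

theorem vol_cont {n : ℕ} {A : Set (Fin n → ℝ)} (hA : IsCompact A) (a : Fin n) :
    Continuous fun c => vol (A ∩ HS (-1) a c) := by
  have e : ∀ c, vol (A ∩ HS (-1) a c) = ∫ x in A, (HS (-1) a c).indicator (fun _ => (1:ℝ)) x := by
    intro c
    rw [setIntegral_indicator (HS_closed _ _ _).measurableSet]
    simp [vol, Measure.real]
  simp_rw [e]
  refine continuous_iff_continuousAt.2 fun c => ?_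
  refine continuousAt_of_dominated (bound := fun _ => 1) ?_ ?_ ?_ ?_
  · refine Filter.Eventually.of_forall fun d => ?_
    exact (measurable_const.indicator (HS_closed _ _ _).measurableSet).aestronglyMeasurable
  · refine Filter.Eventually.of_forall fun d => Filter.Eventually.of_forall fun x => ?_
    refine (norm_indicator_le_norm_self _ _).trans (by simp)
  · exact integrableOn_const hA.measure_lt_top.ne
  · refine ae_restrict_of_ae ?_
    have h0 : volume {x : Fin n → ℝ | x a = c} = 0 := by
      rw [volume_pi]; exact Measure.pi_hyperplane (α := fun _ : Fin n => ℝ) (fun _ => volume) a c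
    filter_upwards [measure_eq_zero_iff_ae_notMem.1 h0] with x hx
    have hx' : x a ≠ c := hx
    rcases lt_or_gt_of_ne hx' with h | h
    · refine (continuousAt_const (y := (1:ℝ))).congr ?_
      filter_upwards [lt_mem_nhds h] with d hd
      rw [Set.indicator_of_mem (mem_HSm.2 hd.le)]
    · refine (continuousAt_const (y := (0:ℝ))).congr ?_
      filter_upwards [gt_mem_nhds h] with d hd
      rw [Set.indicator_of_notMem (fun h => absurd (mem_HSm.1 h) (not_le.2 hd))]

theorem median {n : ℕ} {A : Set (Fin n → ℝ)} (hA : IsCompact A) (a : Fin n) :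
    ∃ c, vol (A ∩ HS 1 a c) = vol A / 2 ∧ vol (A ∩ HS (-1) a c) = vol A / 2 := by
  have hv : 0 ≤ vol A := ENNReal.toReal_nonneg
  obtain ⟨R, hR⟩ := hA.isBounded.exists_norm_le
  have hlo : vol (A ∩ HS (-1) a (-(|R| + 1))) = 0 := by
    have : A ∩ HS (-1) a (-(|R| + 1)) = ∅ := by
      ext x
      simp only [Set.mem_inter_iff, mem_HSm, Set.mem_empty_iff_false, iff_false, not_and, not_le]
      intro hx
      have h1 := (norm_le_pi_norm x a).trans (hR x hx)
      rw [Real.norm_eq_abs] at h1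
      linarith [neg_abs_le (x a), le_abs_self R]
    rw [this]; simp [vol]
  have hhi : vol (A ∩ HS (-1) a (|R| + 1)) = vol A := by
    have : A ∩ HS (-1) a (|R| + 1) = A := by
      refine Set.inter_eq_left.2 fun x hx => mem_HSm.2 ?_
      have h1 := (norm_le_pi_norm x a).trans (hR x hx)
      rw [Real.norm_eq_abs] at h1
      linarith [le_abs_self (x a), le_abs_self R]
    rw [this]
  have hivt := intermediate_value_Icc (f := fun c => vol (A ∩ HS (-1) a c))
    (show -(|R| + 1) ≤ |R| + 1 by linarith [abs_nonneg R]) (vol_cont hA a).continuousOn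
  obtain ⟨c, -, hc⟩ := hivt (show vol A / 2 ∈ _ by
    rw [hlo, hhi]; constructor <;> linarith)
  have hc' : vol (A ∩ HS (-1) a c) = vol A / 2 := hc
  have := vol_halves A hA.measure_lt_top.ne a c
  exact ⟨c, by linarith, hc'⟩

theorem width_shrink {n : ℕ} {C : Set (Fin n → ℝ)} (hC : IsCompact C)
    (hconv : Convex ℝ C) (hpos : 0 < vol C) (a : Fin n) (s : ℝ) (hs : s = 1 ∨ s = -1) (c w θ : ℝ)
    (hθ0 : 0 ≤ θ) (hθ : 1 / 2 ≤ θ ^ n) (hhalf : vol (C ∩ HS s a c) = vol C / 2)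
    (hw : ∀ x ∈ C, ∀ y ∈ C, x a - y a ≤ w) :
    ∀ x ∈ C ∩ HS s a c, ∀ y ∈ C ∩ HS s a c, x a - y a ≤ w * θ := by
  have key : ∀ p ∈ C ∩ HS s a c, ∀ q ∈ C ∩ HS s a c, s * p a - s * q a ≤ w * θ := by
    intro p hp q hq
    have hw0 : 0 ≤ w := by simpa using hw p hp.1 p hp.1
    have hws : ∀ x ∈ C, ∀ y ∈ C, s * x a - s * y a ≤ w := by
      intro x hx y hy
      rcases hs with rfl | rfl
      · have := hw x hx y hy; linarith
      · have := hw y hy x hx; linarith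
    rcases le_or_gt (s * p a - s * q a) 0 with h0 | h0
    · exact h0.trans (mul_nonneg hw0 hθ0)
    have hdw := hws p hp.1 q hq.1
    have hwpos : 0 < w := by linarith
    set d := s * p a - s * q a with hd
    set t := d / w with ht
    have ht0 : 0 ≤ t := by positivity
    have ht1 : t ≤ 1 := (div_le_one hwpos).2 hdw
    have htw : t * w = d := div_mul_cancel₀ _ hwpos.ne'
    have hsub : AffineMap.homothety p t '' C ⊆ C ∩ HS s a c := by
      rintro _ ⟨z, hz, rfl⟩
      rw [AffineMap.homothety_eq_lineMap]
      refine ⟨hconv.lineMap_mem hp.1 hz ⟨ht0, ht1⟩, ?_⟩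
      have h1 : s * (c - q a) ≤ 0 := hq.2
      have h2 := mul_le_mul_of_nonneg_left (hws p hp.1 z hz) ht0
      show s * (c - _) ≤ 0
      simp only [AffineMap.lineMap_apply, vsub_eq_sub, vadd_eq_add, Pi.add_apply, Pi.smul_apply,
        Pi.sub_apply, smul_eq_mul]
      nlinarith
    have hv : vol (AffineMap.homothety p t '' C) ≤ vol (C ∩ HS s a c) :=
      ENNReal.toReal_mono (hC.inter_right (HS_closed _ _ _)).measure_lt_top.ne (measure_mono hsub)
    rw [hhalf] at hv
    unfold vol at hv hpos
    rw [Measure.addHaar_image_homothety, ENNReal.toReal_mul, ENNReal.toReal_ofReal (abs_nonneg _),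
      abs_of_nonneg (by positivity), Module.finrank_fin_fun] at hv
    have htn : t ^ n ≤ 1 / 2 := by
      by_contra hcon
      push Not at hcon
      nlinarith
    have htθ : t ≤ θ := by
      by_contra hcon
      push Not at hcon
      rcases Nat.eq_zero_or_pos n with h | h
      · subst h; norm_num at htn
      · have := pow_lt_pow_left₀ hcon hθ0 h.ne'
        linarith
    rw [← htw, mul_comm]
    exact mul_le_mul_of_nonneg_left htθ hw0
  intro x hx y hy
  rcases hs with rfl | rfl
  · have := key x hx y hy; linarith
  · have := key y hy x hx; linarith

theorem Icc_HS1 {n : ℕ} (l r : Fin n → ℝ) (a : Fin n) (c : ℝ) :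
    Set.Icc l r ∩ HS 1 a c = Set.Icc (Function.update l a (max (l a) c)) r := by
  ext x
  simp only [Set.mem_inter_iff, Set.mem_Icc, mem_HS1, Pi.le_def]
  constructor
  · rintro ⟨⟨h1, h2⟩, h3⟩
    refine ⟨fun j => ?_, h2⟩
    by_cases hj : j = a
    · subst hj; simp [h1 j, h3]
    · simp [hj, h1 j]
  · rintro ⟨h1, h2⟩
    have ha := h1 a
    simp only [Function.update_self, max_le_iff] at ha
    refine ⟨⟨fun j => ?_, h2⟩, ha.2⟩
    by_cases hj : j = a
    · subst hj; exact ha.1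
    · simpa [hj] using h1 j

theorem Icc_HSm {n : ℕ} (l r : Fin n → ℝ) (a : Fin n) (c : ℝ) :
    Set.Icc l r ∩ HS (-1) a c = Set.Icc l (Function.update r a (min (r a) c)) := by
  ext x
  simp only [Set.mem_inter_iff, Set.mem_Icc, mem_HSm, Pi.le_def]
  constructor
  · rintro ⟨⟨h1, h2⟩, h3⟩
    refine ⟨h1, fun j => ?_⟩
    by_cases hj : j = a
    · subst hj; simp [h2 j, h3]
    · simp [hj, h2 j]
  · rintro ⟨h1, h2⟩
    have ha := h2 a
    simp only [Function.update_self, le_min_iff] at ha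
    refine ⟨⟨h1, fun j => ?_⟩, ha.2⟩
    by_cases hj : j = a
    · subst hj; exact ha.1
    · simpa [hj] using h2 j

theorem small_cell {n : ℕ} {K : Set (Fin n → ℝ)} {l r p : Fin n → ℝ} {δ : ℝ} (hδ : 0 < δ)
    (hp : p ∈ K ∩ Set.Icc l r) (hb : Metric.closedBall p δ ⊆ K)
    (hw : ∀ a, ∀ x ∈ K ∩ Set.Icc l r, ∀ y ∈ K ∩ Set.Icc l r, x a - y a ≤ δ / 2) :
    K ∩ Set.Icc l r = Set.Icc l r := by
  refine Set.inter_eq_right.2 fun y hy => ?_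
  by_contra hyK
  have hd : δ < ‖y - p‖ := by
    by_contra hcon
    push Not at hcon
    exact hyK (hb (by rwa [mem_closedBall_iff_norm]))
  have hd0 : 0 < ‖y - p‖ := hδ.trans hd
  set t := δ / ‖y - p‖ with ht
  have ht0 : 0 ≤ t := by positivity
  have ht1 : t ≤ 1 := (div_le_one hd0).2 hd.le
  set z := AffineMap.lineMap p y t with hz
  have hzp : z - p = t • (y - p) := by
    rw [hz, AffineMap.lineMap_apply]; simp
  have hnorm : ‖z - p‖ = δ := by
    rw [hzp, norm_smul, Real.norm_of_nonneg ht0, ht, div_mul_cancel₀ _ hd0.ne']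
  have hzC : z ∈ K ∩ Set.Icc l r :=
    ⟨hb (by rw [mem_closedBall_iff_norm, hnorm]),
      (convex_Icc l r).lineMap_mem hp.2 hy ⟨ht0, ht1⟩⟩
  have : ‖z - p‖ ≤ δ / 2 := by
    refine (pi_norm_le_iff_of_nonneg (by positivity)).2 fun a => ?_
    rw [Pi.sub_apply, Real.norm_eq_abs, abs_le]
    have h1 := hw a z hzC p hp
    have h2 := hw a p hp z hzC
    constructor <;> linarith
  linarith

theorem main_ind {n : ℕ} (hn : 1 ≤ n) {K : Fin n → Set (Fin n → ℝ)} (hK : ∀ i, IsCompact (K i))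
    (hconv : ∀ i, Convex ℝ (K i)) (hV : ∀ i, 0 < vol (K i)) (bad : Fin n → Set (Fin n → ℝ))
    (δ : ℝ) (hδ : 0 < δ) (hgood : ∀ i, ∀ x ∈ K i, x ∉ bad i → Metric.closedBall x δ ⊆ K i)
    (θ : ℝ) (hθ0 : 0 ≤ θ) (hθ : 1 / 2 ≤ θ ^ n) (L : List (Fin n)) :
    ∀ (w : Fin n → ℝ) (l r : Fin n → Fin n → ℝ) (ρ : ℝ), 0 < ρ →
      (∀ i, vol (K i ∩ Set.Icc (l i) (r i)) = ρ * vol (K i)) →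
      (∀ i a, ∀ x ∈ K i ∩ Set.Icc (l i) (r i), ∀ y ∈ K i ∩ Set.Icc (l i) (r i),
        x a - y a ≤ w a) →
      (∀ a, w a * θ ^ (L.count a) ≤ δ / 2) →
      (n.factorial : ℝ) * (∏ i, vol (K i)) ^ ((1:ℝ)/n) *
        (ρ - ∑ i, vol (K i ∩ Set.Icc (l i) (r i) ∩ bad i) / vol (K i)) ≤
        MV n (fun i => K i ∩ Set.Icc (l i) (r i)) := by
  have hP : 0 ≤ (n.factorial : ℝ) * (∏ i, vol (K i)) ^ ((1:ℝ)/n) :=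
    mul_nonneg (by positivity) (Real.rpow_nonneg (Finset.prod_nonneg fun i _ => (hV i).le) _)
  have hn0 : (n : ℝ) ≠ 0 := by positivity
  induction L with
  | nil =>
    intro w l r ρ hρ hvol hw hL
    have hcpt : ∀ i, IsCompact (K i ∩ Set.Icc (l i) (r i)) := fun i =>
      (hK i).inter_right isClosed_Icc
    have hcv : ∀ i, Convex ℝ (K i ∩ Set.Icc (l i) (r i)) := fun i =>
      (hconv i).inter (convex_Icc _ _)
    have hpos : ∀ i, 0 < vol (K i ∩ Set.Icc (l i) (r i)) := fun i => by
      rw [hvol]; exact mul_pos hρ (hV i)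
    have hterm : ∀ i, 0 ≤ vol (K i ∩ Set.Icc (l i) (r i) ∩ bad i) / vol (K i) := fun i =>
      div_nonneg ENNReal.toReal_nonneg (hV i).le
    by_cases hb : ∃ i, K i ∩ Set.Icc (l i) (r i) ⊆ bad i
    · obtain ⟨i, hi⟩ := hb
      have h1 := Finset.single_le_sum (fun j _ => hterm j) (Finset.mem_univ i)
      rw [Set.inter_eq_left.2 hi, hvol, mul_div_cancel_right₀ _ (hV i).ne'] at h1
      have h2 : 0 ≤ MV n (fun i => K i ∩ Set.Icc (l i) (r i)) :=
        (MV_lintegral hn (w := fun _ _ => 1) fun i => ⟨hcpt i, hcv i, int_of_pos (hcv i) (hpos i),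
          continuous_const, fun _ => one_pos⟩).2
      refine le_trans (mul_nonpos_of_nonneg_of_nonpos hP ?_) h2
      linarith
    · push Not at hb
      have hbox : ∀ i, K i ∩ Set.Icc (l i) (r i) = Set.Icc (l i) (r i) ∧ l i ≤ r i := by
        intro i
        obtain ⟨p, hp, hpb⟩ := Set.not_subset.1 (hb i)
        refine ⟨small_cell hδ hp (hgood i p hp.1 hpb) fun a x hx y hy => ?_,
          hp.2.1.trans hp.2.2⟩
        have := hL a
        simp only [List.count_nil, pow_zero, mul_one] at this
        exact (hw i a x hx y hy).trans this
      have hMV := MV_box hn l r fun i => (hbox i).2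
      have e1 : (fun i => K i ∩ Set.Icc (l i) (r i)) = fun i => Set.Icc (l i) (r i) :=
        funext fun i => (hbox i).1
      rw [e1]
      refine le_trans ?_ hMV
      have e2 : ∏ i, vol (Set.Icc (l i) (r i)) = ρ ^ n * ∏ i, vol (K i) := by
        have : ∀ i, vol (Set.Icc (l i) (r i)) = ρ * vol (K i) := fun i => by
          rw [← hvol i, (hbox i).1]
        simp_rw [this]
        rw [Finset.prod_mul_distrib]; simp
      rw [e2, Real.mul_rpow (by positivity) (Finset.prod_nonneg fun i _ => (hV i).le),
        ← Real.rpow_natCast, ← Real.rpow_mul hρ.le, mul_one_div_cancel hn0, Real.rpow_one,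
        mul_comm ρ, ← mul_assoc]
      refine mul_le_mul_of_nonneg_left ?_ hP
      have := Finset.sum_nonneg fun i (_ : i ∈ Finset.univ) => hterm i
      linarith
  | cons a L ih =>
    intro w l r ρ hρ hvol hw hL
    have hcpt : ∀ i, IsCompact (K i ∩ Set.Icc (l i) (r i)) := fun i =>
      (hK i).inter_right isClosed_Icc
    have hcv : ∀ i, Convex ℝ (K i ∩ Set.Icc (l i) (r i)) := fun i =>
      (hconv i).inter (convex_Icc _ _)
    have hpos : ∀ i, 0 < vol (K i ∩ Set.Icc (l i) (r i)) := fun i => by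
      rw [hvol]; exact mul_pos hρ (hV i)
    choose c hc1 hc2 using fun i => median (hcpt i) a
    have hcut := MV_cut hn hcpt hcv a c
      (fun i => int_of_pos ((hcv i).inter (HS_convex _ _ _)) (by rw [hc1]; linarith [hpos i]))
      (fun i => int_of_pos ((hcv i).inter (HS_convex _ _ _)) (by rw [hc2]; linarith [hpos i]))
    have hws : ∀ s, s = 1 ∨ s = -1 →
        (∀ i, vol (K i ∩ Set.Icc (l i) (r i) ∩ HS s a (c i)) =
          vol (K i ∩ Set.Icc (l i) (r i)) / 2) → ∀ i b,
        ∀ x ∈ K i ∩ Set.Icc (l i) (r i) ∩ HS s a (c i),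
        ∀ y ∈ K i ∩ Set.Icc (l i) (r i) ∩ HS s a (c i),
        x b - y b ≤ Function.update w a (w a * θ) b := by
      intro s hs hh i b x hx y hy
      by_cases hb : b = a
      · subst hb
        rw [Function.update_self]
        exact width_shrink (hcpt i) (hcv i) (hpos i) b s hs (c i) (w b) θ hθ0 hθ (hh i)
          (hw i b) x hx y hy
      · rw [Function.update_of_ne hb]
        exact hw i b x hx.1 y hy.1
    have hL' : ∀ b, Function.update w a (w a * θ) b * θ ^ (L.count b) ≤ δ / 2 := by
      intro b
      have := hL b
      by_cases hb : b = a
      · subst hb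
        rw [List.count_cons_self, pow_succ'] at this
        rw [Function.update_self]; linarith
      · rw [List.count_cons_of_ne (Ne.symm hb)] at this
        rwa [Function.update_of_ne hb]
    have e1 : ∀ i, K i ∩ Set.Icc (l i) (r i) ∩ HS 1 a (c i) =
        K i ∩ Set.Icc (Function.update (l i) a (max (l i a) (c i))) (r i) := fun i => by
      rw [Set.inter_assoc, Icc_HS1]
    have e2 : ∀ i, K i ∩ Set.Icc (l i) (r i) ∩ HS (-1) a (c i) =
        K i ∩ Set.Icc (l i) (Function.update (r i) a (min (r i a) (c i))) := fun i => by
      rw [Set.inter_assoc, Icc_HSm]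
    have i1 := ih (Function.update w a (w a * θ))
      (fun i => Function.update (l i) a (max (l i a) (c i))) r (ρ / 2) (by positivity)
      (fun i => by rw [← e1, hc1, hvol]; ring)
      (fun i => by rw [← e1]; exact hws 1 (Or.inl rfl) hc1 i) hL'
    have i2 := ih (Function.update w a (w a * θ))
      l (fun i => Function.update (r i) a (min (r i a) (c i))) (ρ / 2) (by positivity)
      (fun i => by rw [← e2, hc2, hvol]; ring)
      (fun i => by rw [← e2]; exact hws (-1) (Or.inr rfl) hc2 i) hL'
    simp_rw [← e1] at i1
    simp_rw [← e2] at i2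
    refine le_trans ?_ hcut
    refine le_trans (le_of_eq ?_) (add_le_add i1 i2)
    have hs : ∀ i, vol (K i ∩ Set.Icc (l i) (r i) ∩ bad i) / vol (K i) =
        vol (K i ∩ Set.Icc (l i) (r i) ∩ HS 1 a (c i) ∩ bad i) / vol (K i) +
        vol (K i ∩ Set.Icc (l i) (r i) ∩ HS (-1) a (c i) ∩ bad i) / vol (K i) := by
      intro i
      rw [← vol_halves (K i ∩ Set.Icc (l i) (r i) ∩ bad i) (ne_top_of_le_ne_top
        (hcpt i).measure_lt_top.ne (measure_mono Set.inter_subset_left)) a (c i), add_div,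
        Set.inter_right_comm _ (bad i), Set.inter_right_comm _ (bad i)]
    simp_rw [hs]
    rw [Finset.sum_add_distrib]
    ring


theorem list_count (n m : ℕ) : ∃ L : List (Fin n), ∀ a, m ≤ L.count a := by
  induction m with
  | zero => exact ⟨[], fun a => Nat.zero_le _⟩
  | succ m ih =>
    obtain ⟨L, hL⟩ := ih
    refine ⟨List.finRange n ++ L, fun a => ?_⟩
    rw [List.count_append]
    have := List.count_pos_iff.2 (List.mem_finRange a)
    have := hL a
    omega

theorem bad_tendsto {n : ℕ} {K : Set (Fin n → ℝ)} (hK : IsCompact K) (hconv : Convex ℝ K) :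
    Filter.Tendsto (fun k : ℕ => vol (K ∩ {x | ¬ Metric.closedBall x (1 / ((k:ℝ) + 1)) ⊆ K}))
      Filter.atTop (nhds 0) := by
  have hcl : ∀ d : ℝ, IsClosed {x | Metric.closedBall x d ⊆ K} := by
    intro d
    have : {x | Metric.closedBall x d ⊆ K} =
        ⋂ v ∈ Metric.closedBall (0 : Fin n → ℝ) d, (fun x => x + v) ⁻¹' K := by
      ext x
      simp only [Set.mem_ofPred_eq, Set.mem_iInter, Set.mem_preimage]
      constructor
      · intro h v hv
        refine h ?_
        rw [mem_closedBall_iff_norm] at hv ⊢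
        simpa using hv
      · intro h y hy
        have := h (y - x) (by rw [mem_closedBall_iff_norm] at hy ⊢; simpa using hy)
        simpa using this
    rw [this]
    exact isClosed_biInter fun v _ => hK.isClosed.preimage (by fun_prop)
  have hanti : Antitone fun k : ℕ => K ∩ {x | ¬ Metric.closedBall x (1 / ((k:ℝ) + 1)) ⊆ K} := by
    intro k m hkm x hx
    refine ⟨hx.1, fun h => hx.2 fun y hy => h ?_⟩
    · exfalso
      refine hx.2 ((Metric.closedBall_subset_closedBall ?_).trans h)
      exact Nat.one_div_le_one_div hkm
  have h1 := tendsto_measure_iInter_atTop (μ := volume)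
    (s := fun k : ℕ => K ∩ {x | ¬ Metric.closedBall x (1 / ((k:ℝ) + 1)) ⊆ K})
    (fun k => (hK.isClosed.measurableSet.inter (hcl _).measurableSet.compl).nullMeasurableSet) hanti
    ⟨0, ne_top_of_le_ne_top hK.measure_lt_top.ne (measure_mono Set.inter_subset_left)⟩
  have h0 : volume (⋂ k : ℕ, K ∩ {x | ¬ Metric.closedBall x (1 / ((k:ℝ) + 1)) ⊆ K}) = 0 := by
    refine measure_mono_null (t := frontier K) ?_ (hconv.addHaar_frontier volume)
    intro x hx
    rw [Set.mem_iInter] at hx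
    refine ⟨subset_closure (hx 0).1, fun hi => ?_⟩
    obtain ⟨ε, hε, hb⟩ := Metric.mem_nhds_iff.1 (mem_interior_iff_mem_nhds.1 hi)
    obtain ⟨k, hk⟩ := exists_nat_one_div_lt hε
    exact (hx k).2 ((Metric.closedBall_subset_ball hk).trans hb)
  rw [h0] at h1
  exact (ENNReal.tendsto_toReal ENNReal.zero_ne_top).comp h1

theorem main_pos {n : ℕ} (hn : 1 ≤ n) {K : Fin n → Set (Fin n → ℝ)} (hK : ∀ i, IsCompact (K i))
    (hconv : ∀ i, Convex ℝ (K i)) (hV : ∀ i, 0 < vol (K i)) :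
    (n.factorial : ℝ) * (∏ i, vol (K i)) ^ ((1:ℝ)/n) ≤ MV n K := by
  have hnpos : (0:ℝ) < n := by exact_mod_cast hn
  have hn1 : (1:ℝ) ≤ n := by exact_mod_cast hn
  let bad : ℕ → Fin n → Set (Fin n → ℝ) := fun k i =>
    {x | ¬ Metric.closedBall x (1 / ((k:ℝ) + 1)) ⊆ K i}
  let θ : ℝ := 1 + -(1 / (2 * n))
  have hθ' : 1 / (2 * (n:ℝ)) ≤ 1 / 2 := by
    apply one_div_le_one_div_of_le <;> linarith
  have hθp : 0 < 1 / (2 * (n:ℝ)) := by positivity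
  have hθ0 : 0 ≤ θ := by simp only [θ]; linarith
  have hθ1 : θ < 1 := by simp only [θ]; linarith
  have hθ : 1 / 2 ≤ θ ^ n := by
    have := one_add_mul_le_pow (a := -(1 / (2 * (n:ℝ)))) (by linarith) n
    refine le_trans (le_of_eq ?_) this
    field_simp; norm_num
  choose R hR using fun i => (hK i).isBounded.exists_norm_le
  let r : ℝ := ∑ i, |R i|
  have hr0 : 0 ≤ r := Finset.sum_nonneg fun i _ => abs_nonneg _
  have hr : ∀ i, ∀ x ∈ K i, ∀ a, |x a| ≤ r := by
    intro i x hx a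
    rw [← Real.norm_eq_abs]
    refine (norm_le_pi_norm x a).trans ((hR i x hx).trans ((le_abs_self _).trans ?_))
    exact Finset.single_le_sum (f := fun i => |R i|) (fun j _ => abs_nonneg _) (Finset.mem_univ i)
  have hbox : ∀ i, K i ∩ Set.Icc (fun _ => -r) (fun _ => r) = K i := fun i =>
    Set.inter_eq_left.2 fun x hx =>
      ⟨fun a => (abs_le.1 (hr i x hx a)).1, fun a => (abs_le.1 (hr i x hx a)).2⟩
  have hk : ∀ k : ℕ, (n.factorial : ℝ) * (∏ i, vol (K i)) ^ ((1:ℝ)/n) *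
      (1 - ∑ i, vol (K i ∩ bad k i) / vol (K i)) ≤ MV n K := by
    intro k
    have hδ : (0:ℝ) < 1 / ((k:ℝ) + 1) := by positivity
    have hlim : Filter.Tendsto (fun m : ℕ => 2 * r * θ ^ m) Filter.atTop (nhds (2 * r * 0)) :=
      (tendsto_pow_atTop_nhds_zero_of_lt_one hθ0 hθ1).const_mul _
    rw [mul_zero] at hlim
    obtain ⟨m, hm⟩ := (hlim.eventually_lt_const (half_pos hδ)).exists
    obtain ⟨L, hL⟩ := list_count n m
    have := main_ind hn hK hconv hV (bad k) (1 / ((k:ℝ) + 1)) hδ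
      (fun i x _ hx => not_not.1 hx) θ hθ0 hθ L (fun _ => 2 * r) (fun _ _ => -r) (fun _ _ => r) 1
      one_pos (fun i => by rw [hbox, one_mul])
      (fun i a x hx y hy => by
        have h1 := abs_le.1 (hr i x hx.1 a)
        have h2 := abs_le.1 (hr i y hy.1 a)
        linarith)
      (fun a => le_trans (mul_le_mul_of_nonneg_left
        (pow_le_pow_of_le_one hθ0 hθ1.le (hL a)) (by positivity)) hm.le)
    simpa only [hbox] using this
  have hT : Filter.Tendsto (fun k : ℕ => (n.factorial : ℝ) * (∏ i, vol (K i)) ^ ((1:ℝ)/n) *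
      (1 - ∑ i, vol (K i ∩ bad k i) / vol (K i))) Filter.atTop
      (nhds ((n.factorial : ℝ) * (∏ i, vol (K i)) ^ ((1:ℝ)/n) *
      (1 - ∑ i, 0 / vol (K i)))) :=
    (tendsto_const_nhds.sub (tendsto_finsetSum _ fun i _ =>
      (bad_tendsto (hK i) (hconv i)).div_const _)).const_mul _
  simp only [zero_div, Finset.sum_const_zero, sub_zero, mul_one] at hT
  exact le_of_tendsto' hT hk

theorem MV_nonneg {n : ℕ} (hn : 1 ≤ n) {K : Fin n → Set (Fin n → ℝ)} (hK : ∀ i, IsCompact (K i))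
    (hne : ∀ i, (K i).Nonempty) (hconv : ∀ i, Convex ℝ (K i)) : 0 ≤ MV n K := by
  let B : ℝ → Set (Fin n → ℝ) := fun e => Metric.closedBall 0 e
  let Ke : ℕ → Fin n → Set (Fin n → ℝ) := fun k i => K i + B (1 / ((k:ℝ) + 1))
  have hsum : ∀ k (S : Finset (Fin n)), ∑ i ∈ S, Ke k i ⊆
      Metric.cthickening (S.card * (1 / ((k:ℝ) + 1))) (∑ i ∈ S, K i) := by
    intro k S
    simp only [Ke]
    rw [Finset.sum_add_distrib]
    rintro _ ⟨x, hx, y, hy, rfl⟩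
    refine Metric.mem_cthickening_of_dist_le _ x _ _ hx ?_
    obtain ⟨g, hg, rfl⟩ := (Set.mem_finsetSum _ _ _).1 hy
    simp only [dist_self_add_left]
    refine (norm_sum_le_of_le S (f := fun i => g i) (n := fun _ => 1 / ((k:ℝ) + 1)) fun i hi => ?_).trans ?_
    · simpa [B] using hg hi
    · simp
  have hsub : ∀ k (S : Finset (Fin n)), ∑ i ∈ S, K i ⊆ ∑ i ∈ S, Ke k i := by
    intro k S
    refine Set.finsetSum_subset_finsetSum S _ _ fun i _ x hx => ?_
    refine ⟨x, hx, 0, ?_, add_zero x⟩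
    simp only [B, Metric.mem_closedBall, dist_self]; positivity
  have hT : ∀ S : Finset (Fin n), Filter.Tendsto (fun k : ℕ => vol (∑ i ∈ S, Ke k i)) Filter.atTop
      (nhds (vol (∑ i ∈ S, K i))) := by
    intro S
    have hc := sum_compact hK S
    refine (ENNReal.tendsto_toReal hc.measure_lt_top.ne).comp ?_
    have h1 := (tendsto_measure_cthickening_of_isCompact (μ := volume) hc).comp
      (show Filter.Tendsto (fun k : ℕ => (S.card : ℝ) * (1 / ((k:ℝ) + 1))) Filter.atTop (nhds 0) by
        simpa using (tendsto_one_div_add_atTop_nhds_zero_nat (𝕜 := ℝ)).const_mul (S.card : ℝ))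
    exact tendsto_of_tendsto_of_tendsto_of_le_of_le tendsto_const_nhds h1
      (fun k => measure_mono (hsub k S)) (fun k => measure_mono (hsum k S))
  have hlim : Filter.Tendsto (fun k => MV n (Ke k)) Filter.atTop (nhds (MV n K)) := by
    simp_rw [MV_eq_sum hn]
    exact tendsto_finsetSum _ fun S _ => (hT S).const_mul _
  refine ge_of_tendsto' hlim fun k => ?_
  have hpos : (0:ℝ) < 1 / ((k:ℝ) + 1) := by positivity
  refine (MV_lintegral hn (w := fun _ _ => 1) fun i => ⟨(hK i).add (isCompact_closedBall _ _),
    (hconv i).add (convex_closedBall _ _), ?_, continuous_const, fun _ => one_pos⟩).2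
  obtain ⟨x, hx⟩ := hne i
  refine ⟨x, mem_interior_iff_mem_nhds.2 (Filter.mem_of_superset (Metric.ball_mem_nhds x hpos) ?_)⟩
  intro y hy
  refine ⟨x, hx, y - x, ?_, by simp⟩
  simp only [mem_closedBall_iff_norm, sub_zero]
  exact (mem_ball_iff_norm.1 hy).le

/-- Case `p = n` of the generalized Hodge type inequality:
`MV(K₁, …, K_n)^n ≥ Π_{i=1}^{n} (n! · vol(K_i))`. -/
theorem generalized_hodge_top {n : ℕ} (hn : 1 ≤ n) (K : Fin n → Set (Fin n → ℝ))
    (hne : ∀ i, (K i).Nonempty) (hcpt : ∀ i, IsCompact (K i))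
    (hconv : ∀ i, Convex ℝ (K i)) :
    MV n K ^ n ≥ ∏ i : Fin n, ((n.factorial : ℝ) * vol (K i)) := by
  have h0 : ∀ i, 0 ≤ vol (K i) := fun i => ENNReal.toReal_nonneg
  by_cases h : ∃ i, vol (K i) = 0
  · obtain ⟨i, hi⟩ := h
    rw [Finset.prod_eq_zero (Finset.mem_univ i) (by rw [hi, mul_zero])]
    exact pow_nonneg (MV_nonneg hn hcpt hne hconv) n
  · push Not at h
    have hm := main_pos hn hcpt hconv fun i => lt_of_le_of_ne (h0 i) (h i).symm
    have hp : 0 ≤ ∏ i, vol (K i) := Finset.prod_nonneg fun i _ => h0 i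
    have := pow_le_pow_left₀ (mul_nonneg (by positivity) (Real.rpow_nonneg hp _)) hm n
    refine le_trans (le_of_eq ?_) this
    rw [mul_pow, one_div, Real.rpow_inv_natCast_pow hp (by omega), Finset.prod_mul_distrib]
    simp
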